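/- For every ε > 0 there exists N₀ such that for all integers N ≥ N₀, the number of pairs (χ, c), where χ is an irreducible complex character of the symmetric group S_N and c is a conjugacy class of S_N, such that the value of χ on c is NOT a multiple of ∏_{p prime, p ≤ (log N)/(log log N)²} p, is at most ε · p(N)². In other words, almost all entries in the character table of S_N are multiples of the product of all primes up to (log N)/(log log N)². -/

import Mathlib

open CategoryTheory

theorem exists_multiset_trace_pow {V : Type*} [AddCommGroup V] [Module ℂ V]
    [FiniteDimensional ℂ V] (T : Module.End ℂ V) {n : ℕ} (hn : 0 < n) (h : T ^ n = 1) :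
    ∃ s : Multiset ℂ, (∀ z ∈ s, z ^ n = 1) ∧
      ∀ k : ℕ, LinearMap.trace ℂ V (T ^ k) = (s.map (· ^ k)).sum := by
  classical
  have hss : T.IsSemisimple := by
    refine Module.End.isSemisimple_of_squarefree_aeval_eq_zero
      (p := (Polynomial.X ^ n - 1 : Polynomial ℂ)) ?_ (by simp [h])
    exact ((Polynomial.X_pow_sub_one_separable_iff).2 (by exact_mod_cast hn.ne')).squarefree
  have htop := hss.iSup_eigenspace_eq_top
  have hind := T.eigenspaces_iSupIndep
  have h_int : DirectSum.IsInternal T.eigenspace :=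
    (DirectSum.isInternal_submodule_iff_iSupIndep_and_iSup_eq_top _).2 ⟨hind, htop⟩
  have hfin : {μ | T.eigenspace μ ≠ ⊥}.Finite := WellFoundedGT.finite_ne_bot_of_iSupIndep hind
  have hroot : ∀ μ, T.eigenspace μ ≠ ⊥ → μ ^ n = 1 := by
    intro μ hμ
    obtain ⟨v, hv, hv0⟩ := Submodule.exists_mem_ne_zero_of_ne_bot hμ
    have h1 : (T ^ n) v = μ ^ n • v :=
      Module.End.HasEigenvector.pow_apply ⟨hv, hv0⟩ n
    rw [h] at h1
    have h2 : (1 - μ ^ n) • v = 0 := by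
      rw [sub_smul, one_smul, ← h1]; simp
    rcases smul_eq_zero.1 h2 with h3 | h3
    · exact (sub_eq_zero.1 h3).symm
    · exact absurd h3 hv0
  refine ⟨∑ μ ∈ hfin.toFinset, Multiset.replicate (Module.finrank ℂ (T.eigenspace μ)) μ, ?_, ?_⟩
  · intro z hz
    obtain ⟨μ, hμ, hz⟩ := Multiset.mem_sum.1 hz
    rw [Multiset.eq_of_mem_replicate hz]
    exact hroot μ (by simpa using hμ)
  · intro k
    have hmaps : ∀ μ, Set.MapsTo (T ^ k) (T.eigenspace μ) (T.eigenspace μ) := fun μ =>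
      Module.End.mapsTo_genEigenspace_of_comm (Commute.pow_right (Commute.refl T) k) μ 1
    rw [LinearMap.trace_eq_sum_trace_restrict' h_int hfin hmaps]
    have : ∀ μ, LinearMap.trace ℂ _ ((T ^ k).restrict (hmaps μ)) =
        Module.finrank ℂ (T.eigenspace μ) • μ ^ k := by
      intro μ
      have : (T ^ k).restrict (hmaps μ) = μ ^ k • LinearMap.id := by
        ext ⟨v, hv⟩
        change (T ^ k) v = μ ^ k • v
        by_cases hv0 : v = 0
        · simp [hv0]
        · exact Module.End.HasEigenvector.pow_apply ⟨hv, hv0⟩ k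
      rw [this, map_smul, LinearMap.trace_id]
      simp [mul_comm]
    have hmap : (∑ μ ∈ hfin.toFinset,
        Multiset.replicate (Module.finrank ℂ (T.eigenspace μ)) μ).map (· ^ k) =
        ∑ μ ∈ hfin.toFinset,
          Multiset.replicate (Module.finrank ℂ (T.eigenspace μ)) (μ ^ k) := by
      rw [← Multiset.coe_mapAddMonoidHom, map_sum]
      simp
    rw [hmap]
    rw [← Multiset.coe_sumAddMonoidHom, map_sum]
    simp [this]

theorem isIntegral_rat_complex {x : ℂ} (hx : IsIntegral ℤ x) {q : ℚ} (hq : (q : ℂ) = x) :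
    ∃ m : ℤ, x = m := by
  have h1 : IsIntegral ℤ q := by
    rw [← hq] at hx
    have : IsIntegral ℤ (algebraMap ℚ ℂ q) := by simpa using hx
    exact (isIntegral_algebraMap_iff (algebraMap ℚ ℂ).injective).1 this
  obtain ⟨m, hm⟩ := IsIntegrallyClosed.isIntegral_iff.1 h1
  refine ⟨m, ?_⟩
  rw [← hq, ← hm]; simp

theorem multiset_sum_isIntegral {s : Multiset ℂ} (h : ∀ z ∈ s, IsIntegral ℤ z) :
    IsIntegral ℤ s.sum :=
  IsIntegral.multiset_sum h

theorem exists_int_eq_sum_of_pow_invariant {s : Multiset ℂ} {n : ℕ} (hn : 0 < n)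
    (hs : ∀ z ∈ s, z ^ n = 1) (hk : ∀ k : ℕ, k.Coprime n → (s.map (· ^ k)).sum = s.sum) :
    ∃ m : ℤ, s.sum = m := by
  have : NeZero n := ⟨hn.ne'⟩
  have hcyc : IsCyclotomicExtension {n} ℚ (CyclotomicField n ℚ) := by
    have : NeZero (n : ℚ) := ⟨by exact_mod_cast hn.ne'⟩
    convert CyclotomicField.isCyclotomicExtension n ℚ using 1
    · rfl
    · exact Subsingleton.elim _ _
  have h_int : IsIntegral ℤ s.sum := by
    refine multiset_sum_isIntegral fun z hz => ?_
    exact IsIntegral.of_pow hn (by rw [hs z hz]; exact isIntegral_one)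
  let φ : (CyclotomicField n ℚ) →ₐ[ℚ] ℂ := IsAlgClosed.lift
  let ζ : (CyclotomicField n ℚ) := IsCyclotomicExtension.zeta n ℚ (CyclotomicField n ℚ)
  have hζ : IsPrimitiveRoot ζ n := IsCyclotomicExtension.zeta_spec n ℚ (CyclotomicField n ℚ)
  have hφζ : IsPrimitiveRoot (φ ζ) n := hζ.map_of_injective φ.injective
  have hex : ∀ z ∈ s, ∃ e : ℕ, (φ ζ) ^ e = z := fun z hz => by
    obtain ⟨i, -, hi⟩ := hφζ.eq_pow_of_pow_eq_one (hs z hz)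
    exact ⟨i, hi⟩
  choose! e he using hex
  let x : (CyclotomicField n ℚ) := (s.map fun z => ζ ^ e z).sum
  have hφx : φ x = s.sum := by
    simp only [x, map_multiset_sum, Multiset.map_map, Function.comp_apply, map_pow]
    rw [Multiset.map_congr rfl he, Multiset.map_id']
  have hfix : x ∈ (⊥ : IntermediateField ℚ (CyclotomicField n ℚ)) := by
    have : IsGalois ℚ (CyclotomicField n ℚ) :=
      IsCyclotomicExtension.isGalois {n} ℚ (CyclotomicField n ℚ)
    have : FiniteDimensional ℚ (CyclotomicField n ℚ) :=
      IsCyclotomicExtension.finiteDimensional {n} ℚ (CyclotomicField n ℚ)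
    rw [IsGalois.mem_bot_iff_fixed]
    intro f
    refine φ.injective (?_ : φ (f x) = φ x)
    have hf : IsPrimitiveRoot (f ζ) n := hζ.map_of_injective f.injective
    obtain ⟨k, -, hkn, hk'⟩ := (hζ.isPrimitiveRoot_iff).1 hf
    rw [hφx]
    rw [← hk k hkn]
    simp only [x, map_multiset_sum, Multiset.map_map, Function.comp_apply, map_pow]
    refine congrArg _ (Multiset.map_congr rfl fun z hz => ?_)
    rw [← hk', map_pow, ← pow_mul, mul_comm, pow_mul, he z hz]
  obtain ⟨q, hq⟩ := IntermediateField.mem_bot.1 hfix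
  refine isIntegral_rat_complex h_int (q := q) ?_
  rw [← hφx, ← hq]; simp

theorem Equiv.Perm.IsCycle.cycleType_pow_eq {α : Type*} [Fintype α] [DecidableEq α]
    {σ : Equiv.Perm α} (hσ : σ.IsCycle) (n : ℕ) :
    (σ ^ n).cycleType = (Multiset.replicate (σ.support.card.gcd n)
      (σ.support.card / σ.support.card.gcd n)).filter (2 ≤ ·) := by
  have hl := hσ.orderOf
  set l := σ.support.card with hl'
  have hl2 : 2 ≤ l := hσ.two_le_card_support
  have hd : 0 < l.gcd n := Nat.gcd_pos_of_pos_left _ (by omega)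
  have hdl : l.gcd n * (l / l.gcd n) = l := Nat.mul_div_cancel' (Nat.gcd_dvd_left _ _)
  by_cases hln : l ∣ n
  · have h1 : σ ^ n = 1 := by rw [← orderOf_dvd_iff_pow_eq_one, hl]; exact hln
    have h2 : l.gcd n = l := Nat.gcd_eq_left hln
    rw [h1, h2, Nat.div_self (by omega)]
    simp only [Equiv.Perm.cycleType_one]
    symm
    rw [Multiset.filter_eq_nil]
    intro a ha
    rw [Multiset.eq_of_mem_replicate ha]; omega
  · have h1 : σ ^ n ≠ 1 := by rw [ne_eq, ← orderOf_dvd_iff_pow_eq_one, hl]; exact hln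
    have hmem : ∀ b ∈ (σ ^ n).cycleType, b = l / l.gcd n := by
      intro b hb
      rw [Equiv.Perm.cycleType_def, Multiset.mem_map] at hb
      obtain ⟨c, hc, rfl⟩ := hb
      have hcc : c ∈ (σ ^ n).cycleFactorsFinset := hc
      rw [Equiv.Perm.mem_cycleFactorsFinset_iff] at hcc
      obtain ⟨hcyc, hagree⟩ := hcc
      simp only [Function.comp_apply]
      rw [← hcyc.orderOf]
      obtain ⟨x, hx⟩ := hcyc.nonempty_support
      have hcof : c = (σ ^ n).cycleOf x :=
        Equiv.Perm.cycle_is_cycleOf hx hc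
      have hxs : σ x ≠ x := by
        have h3 := hagree x hx
        intro h4
        rw [Equiv.Perm.mem_support] at hx
        apply hx
        rw [h3]
        exact Equiv.Perm.pow_apply_eq_self_of_apply_eq_self h4 n
      have key : ∀ j : ℕ, c ^ j = 1 ↔ l / l.gcd n ∣ j := by
        intro j
        rw [hcyc.pow_eq_one_iff' (Equiv.Perm.mem_support.1 hx), hcof,
          Equiv.Perm.cycleOf_pow_apply_self, ← pow_mul, ← hσ.pow_eq_one_iff' hxs,
          ← orderOf_dvd_iff_pow_eq_one, hl]
        constructor
        · intro h
          have hco : (l / l.gcd n).Coprime (n / l.gcd n) := Nat.coprime_div_gcd_div_gcd hd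
          refine hco.dvd_of_dvd_mul_left ?_
          rw [← Nat.mul_dvd_mul_iff_left hd, hdl, ← mul_assoc,
            Nat.mul_div_cancel' (Nat.gcd_dvd_right _ _)]
          exact h
        · rintro h
          have h6 := Nat.mul_dvd_mul (Nat.gcd_dvd_right l n) h
          rwa [hdl] at h6
      apply Nat.dvd_antisymm
      · rw [orderOf_dvd_iff_pow_eq_one, key]
      · exact (key (orderOf c)).1 (pow_orderOf_eq_one c)
    have hrep := Multiset.eq_replicate_card.2 hmem
    have hsum : (σ ^ n).cycleType.sum = l := by
      rw [Equiv.Perm.sum_cycleType, hσ.support_pow_eq_iff.2 (by rwa [hl])]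
    have hcard : Multiset.card (σ ^ n).cycleType = l.gcd n := by
      rw [hrep, Multiset.sum_replicate, smul_eq_mul] at hsum
      have h5 : Multiset.card (σ ^ n).cycleType * (l / l.gcd n) = l.gcd n * (l / l.gcd n) := by
        rw [hdl]; exact hsum
      exact Nat.eq_of_mul_eq_mul_right (Nat.div_pos (Nat.gcd_le_left _ (by omega)) hd) h5
    rw [hcard] at hrep
    rw [hrep]
    symm
    rw [Multiset.filter_eq_self]
    intro a ha
    rw [← hrep] at ha
    exact Equiv.Perm.two_le_of_mem_cycleType ha

theorem Equiv.Perm.cycleType_pow_eq {α : Type*} [Fintype α] [DecidableEq α]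
    (σ : Equiv.Perm α) (n : ℕ) :
    (σ ^ n).cycleType =
      (σ.cycleType.bind fun l => Multiset.replicate (l.gcd n) (l / l.gcd n)).filter (2 ≤ ·) := by
  induction σ using Equiv.Perm.cycle_induction_on with
  | base_one => simp
  | base_cycles σ hσ => rw [hσ.cycleType_pow_eq, hσ.cycleType]; simp
  | induction_disjoint σ τ hd hc ih1 ih2 =>
    rw [hd.commute.mul_pow, (hd.pow_disjoint_pow n n).cycleType_mul, hd.cycleType_mul, ih1, ih2,
      Multiset.add_bind, Multiset.filter_add]

theorem Equiv.Perm.isConj_pow_of_coprime {α : Type*} [Fintype α] [DecidableEq α]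
    (σ : Equiv.Perm α) {k : ℕ} (hk : k.Coprime (orderOf σ)) : IsConj σ (σ ^ k) := by
  rw [Equiv.Perm.isConj_iff_cycleType_eq, Equiv.Perm.cycleType_pow_eq]
  have : (σ.cycleType.bind fun l => Multiset.replicate (l.gcd k) (l / l.gcd k)) =
      σ.cycleType.bind fun l => {l} := by
    refine Multiset.bind_congr fun l hl => ?_
    have h1 : l.gcd k = 1 :=
      (Nat.Coprime.coprime_dvd_right (Equiv.Perm.dvd_of_mem_cycleType hl) hk).symm
    simp [h1]
  rw [this, Multiset.bind_singleton, Multiset.map_id', eq_comm, Multiset.filter_eq_self]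
  exact fun a ha => Equiv.Perm.two_le_of_mem_cycleType ha

theorem exists_multiset_sum_pow_prime {R : Type*} [CommRing R] {p : ℕ} (hp : p.Prime)
    (s : Multiset R) : ∃ r : R, s.sum ^ p = (s.map (· ^ p)).sum + p * r := by
  induction s using Multiset.induction_on with
  | empty => exact ⟨0, by simp [hp.ne_zero]⟩
  | cons a s ih =>
    obtain ⟨r, hr⟩ := ih
    obtain ⟨r', hr'⟩ := exists_add_pow_prime_eq hp a s.sum
    refine ⟨r + a * s.sum * r', ?_⟩
    rw [Multiset.sum_cons, hr', hr, Multiset.map_cons, Multiset.sum_cons]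
    ring

section
variable {N : ℕ}

theorem exists_int_character (V : FDRep ℂ (Equiv.Perm (Fin N))) (g : Equiv.Perm (Fin N)) :
    ∃ m : ℤ, V.character g = m := by
  have hpos := orderOf_pos g
  obtain ⟨s, hs, htr⟩ := exists_multiset_trace_pow (V.ρ g) hpos
    (by rw [← map_pow, pow_orderOf_eq_one, map_one])
  have h1 : V.character g = s.sum := by
    have := htr 1
    simpa [FDRep.character] using this
  rw [h1]
  refine exists_int_eq_sum_of_pow_invariant hpos hs fun k hk => ?_
  rw [← htr k, ← map_pow, ← h1]
  obtain ⟨c, hc⟩ := isConj_iff.1 (g.isConj_pow_of_coprime hk)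
  rw [← hc]
  exact V.char_conj g c

theorem character_pow_prime_dvd {p : ℕ} (hp : p.Prime) (V : FDRep ℂ (Equiv.Perm (Fin N)))
    (g : Equiv.Perm (Fin N)) {a b : ℤ} (ha : V.character g = a) (hb : V.character (g ^ p) = b) :
    (p : ℤ) ∣ a - b := by
  have hpos := orderOf_pos g
  obtain ⟨s, hs, htr⟩ := exists_multiset_trace_pow (V.ρ g) hpos
    (by rw [← map_pow, pow_orderOf_eq_one, map_one])
  have h1 : s.sum = a := by
    have := htr 1
    simpa [FDRep.character, ← ha] using this.symm
  have h2 : (s.map (· ^ p)).sum = b := by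
    rw [← htr p, ← map_pow, ← hb]; rfl
  have h_int : ∀ z ∈ s, IsIntegral ℤ z := fun z hz =>
    IsIntegral.of_pow hpos (by rw [hs z hz]; exact isIntegral_one)
  obtain ⟨t, ht⟩ : ∃ t : Multiset (integralClosure ℤ ℂ), t.map Subtype.val = s :=
    ⟨s.attach.map fun z => ⟨z.1, h_int z.1 z.2⟩, by simp⟩
  obtain ⟨r, hr⟩ := exists_multiset_sum_pow_prime hp t
  have h3 := congrArg (algebraMap (integralClosure ℤ ℂ) ℂ) hr
  rw [map_add, map_pow, map_mul, map_multiset_sum, map_multiset_sum, Multiset.map_map] at h3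
  have e1 : t.map (algebraMap (integralClosure ℤ ℂ) ℂ) = s := ht
  have e2 : t.map (algebraMap (integralClosure ℤ ℂ) ℂ ∘ fun x => x ^ p) = s.map (· ^ p) := by
    rw [← e1, Multiset.map_map]; rfl
  rw [e1, e2, h1, h2] at h3
  have hp0 : (p : ℂ) ≠ 0 := by exact_mod_cast hp.ne_zero
  obtain ⟨m, hm⟩ := isIntegral_rat_complex (x := algebraMap (integralClosure ℤ ℂ) ℂ r)
    (q := ((a : ℚ) ^ p - b) / p) r.2 (by
      push_cast
      rw [div_eq_iff hp0, h3]
      push_cast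
      simp; ring)
  rw [hm] at h3
  have h4 : a ^ p = b + p * m := by
    have h5 : ((a ^ p : ℤ) : ℂ) = ((b + p * m : ℤ) : ℂ) := by
      push_cast; rw [h3]; simp
    exact_mod_cast h5
  have hfact : Fact p.Prime := ⟨hp⟩
  have h6 : (p : ℤ) ∣ a ^ p - a := by
    rw [← ZMod.intCast_zmod_eq_zero_iff_dvd]
    simp [ZMod.pow_card]
  have : a - b = p * m - (a ^ p - a) := by rw [h4]; ring
  rw [this]
  exact dvd_sub (Dvd.intro _ rfl) h6

theorem character_pow_prime_pow_dvd {p : ℕ} (hp : p.Prime) (V : FDRep ℂ (Equiv.Perm (Fin N)))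
    (k : ℕ) (g : Equiv.Perm (Fin N)) {a b : ℤ} (ha : V.character g = a)
    (hb : V.character (g ^ p ^ k) = b) : (p : ℤ) ∣ a - b := by
  induction k generalizing b with
  | zero =>
    have : a = b := by
      have : (a : ℂ) = b := by rw [← ha, ← hb]; simp
      exact_mod_cast this
    simp [this]
  | succ k ih =>
    obtain ⟨c, hc⟩ := exists_int_character V (g ^ p ^ k)
    have h1 := ih hc
    rw [pow_succ, pow_mul] at hb
    have h2 := character_pow_prime_dvd hp V _ hc hb
    have : a - b = (a - c) + (c - b) := by ring
    rw [this]; exact dvd_add h1 h2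

end

theorem isIntegral_trace_of_pow_succ_eq {V : Type*} [AddCommGroup V] [Module ℂ V]
    [FiniteDimensional ℂ V] (T : Module.End ℂ V) {n : ℕ} (hn : 0 < n) (h : T ^ (n + 1) = T) :
    IsIntegral ℤ (LinearMap.trace ℂ V T) := by
  rw [Module.End.trace_eq_sum_roots_charpoly_of_splits (IsAlgClosed.splits _)]
  refine IsIntegral.multiset_sum fun z hz => ?_
  have hev : T.HasEigenvalue z :=
    (Module.End.hasEigenvalue_iff_isRoot_charpoly T z).2 (Polynomial.isRoot_of_mem_roots hz)
  obtain ⟨v, hv⟩ := hev.exists_hasEigenvector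
  have h1 := hv.pow_apply (n + 1)
  rw [h, hv.apply_eq_smul] at h1
  have h2 : z = z ^ (n + 1) := smul_left_injective ℂ hv.2 h1
  rcases eq_or_ne z 0 with h0 | h0
  · rw [h0]; exact isIntegral_zero
  · refine IsIntegral.of_pow hn ?_
    have : z ^ n = 1 := by
      rw [pow_succ] at h2
      exact mul_right_cancel₀ h0 (by rw [← h2, one_mul])
    rw [this]; exact isIntegral_one

theorem isIntegral_average_trace {G H V : Type*} [Group G] [Finite G] [Group H] [Fintype H]
    [AddCommGroup V] [Module ℂ V] [FiniteDimensional ℂ V] (ρ : Representation ℂ G V)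
    (φ : H →* G) {g : G} (hg : ∀ h, Commute (φ h) g) :
    IsIntegral ℤ ((Fintype.card H : ℂ)⁻¹ * ∑ h, LinearMap.trace ℂ V (ρ (φ h * g))) := by
  have hc : (Fintype.card H : ℂ) ≠ 0 := by exact_mod_cast Fintype.card_ne_zero
  set P : Module.End ℂ V := (Fintype.card H : ℂ)⁻¹ • ∑ h, ρ (φ h) with hP
  have hPh : ∀ h, P * ρ (φ h) = P := by
    intro h
    rw [hP, smul_mul_assoc, Finset.sum_mul]
    congr 1
    simp_rw [← map_mul]
    exact Equiv.sum_comp (Equiv.mulRight h) fun x => ρ (φ x)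
  have hPP : P * P = P := by
    nth_rewrite 2 [hP]
    rw [mul_smul_comm, Finset.mul_sum]
    simp_rw [hPh]
    rw [Finset.sum_const, Finset.card_univ, ← Nat.cast_smul_eq_nsmul ℂ, smul_smul,
      inv_mul_cancel₀ hc, one_smul]
  have hcomm : Commute P (ρ g) := by
    rw [hP]
    refine Commute.smul_left (Commute.sum_left _ _ _ fun h _ => ?_) _
    exact (hg h).map ρ
  have hpow : ∀ n, P ^ (n + 1) = P := by
    intro n
    induction n with
    | zero => simp
    | succ n ih => rw [pow_succ, ih, hPP]
  have htr : (Fintype.card H : ℂ)⁻¹ * ∑ h, LinearMap.trace ℂ V (ρ (φ h * g)) =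
      LinearMap.trace ℂ V (P * ρ g) := by
    rw [hP, smul_mul_assoc, Finset.sum_mul, map_smul, map_sum, smul_eq_mul]
    simp_rw [map_mul]
  rw [htr]
  have := Fintype.ofFinite G
  refine isIntegral_trace_of_pow_succ_eq _ (orderOf_pos g) ?_
  rw [hcomm.mul_pow, hpow, ← map_pow, pow_succ, pow_orderOf_eq_one, one_mul]

/-- The integer-valued functions on `S_N` which are irreducible characters. -/
def IsIrreducibleIntCharacter {N : ℕ} (a : Equiv.Perm (Fin N) → ℤ) : Prop :=
  ∃ V : FDRep ℂ (Equiv.Perm (Fin N)), CategoryTheory.Simple V ∧ ∀ g, V.character g = a g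

namespace IsIrreducibleIntCharacter
variable {N : ℕ} {a b : Equiv.Perm (Fin N) → ℤ}

theorem exists_sum_sq_eq (ha : IsIrreducibleIntCharacter a) {H : Type*} [Group H] [Fintype H]
    (φ : H →* Equiv.Perm (Fin N)) {g : Equiv.Perm (Fin N)} (hg : ∀ h, Commute (φ h) g) :
    ∃ m : ℤ, ∑ h, a (φ h * g) ^ 2 = Fintype.card H * m := by
  obtain ⟨V, -, hV⟩ := ha
  have h1 := isIntegral_average_trace (Representation.tprod V.ρ V.ρ) φ hg
  have hc : (Fintype.card H : ℂ) ≠ 0 := by exact_mod_cast Fintype.card_ne_zero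
  have h2 : ∀ x, LinearMap.trace ℂ _ (Representation.tprod V.ρ V.ρ x) = (a x : ℂ) ^ 2 := by
    intro x
    rw [Representation.tprod_apply, LinearMap.trace_tensorProduct', ← hV, sq]
    rfl
  simp_rw [h2] at h1
  obtain ⟨m, hm⟩ := isIntegral_rat_complex h1
    (q := (Fintype.card H : ℚ)⁻¹ * ∑ h, (a (φ h * g) : ℚ) ^ 2) (by push_cast; rfl)
  refine ⟨m, ?_⟩
  rw [inv_mul_eq_iff_eq_mul₀ hc] at hm
  exact_mod_cast hm

theorem card_le_sum_sq (ha : IsIrreducibleIntCharacter a) {H : Type*} [Group H] [Fintype H]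
    (φ : H →* Equiv.Perm (Fin N)) {g : Equiv.Perm (Fin N)} (hg : ∀ h, Commute (φ h) g)
    (hne : ∃ h, a (φ h * g) ≠ 0) :
    (Fintype.card H : ℤ) ≤ ∑ h, a (φ h * g) ^ 2 := by
  obtain ⟨m, hm⟩ := ha.exists_sum_sq_eq φ hg
  obtain ⟨h0, h0'⟩ := hne
  have hpos : 0 < ∑ h, a (φ h * g) ^ 2 :=
    Finset.sum_pos' (fun _ _ => sq_nonneg _) ⟨h0, Finset.mem_univ _, by positivity⟩
  have hc : (0 : ℤ) < Fintype.card H := by exact_mod_cast Fintype.card_pos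
  rw [hm] at hpos ⊢
  have hm1 : 0 < m := pos_of_mul_pos_right hpos hc.le
  nlinarith

theorem eq_of_isConj (ha : IsIrreducibleIntCharacter a) {g h : Equiv.Perm (Fin N)}
    (hgh : IsConj g h) : a g = a h := by
  obtain ⟨V, -, hV⟩ := ha
  obtain ⟨c, hc⟩ := isConj_iff.1 hgh
  have := V.char_conj g c
  rw [hc, hV, hV] at this
  exact_mod_cast this.symm

theorem dvd_sub_of_isConj_pow (ha : IsIrreducibleIntCharacter a) {p : ℕ} (hp : p.Prime) {k : ℕ}
    {g h : Equiv.Perm (Fin N)} (hgh : IsConj (g ^ p ^ k) (h ^ p ^ k)) :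
    (p : ℤ) ∣ a g - a h := by
  have h3 := ha.eq_of_isConj hgh
  obtain ⟨V, -, hV⟩ := ha
  have h1 := character_pow_prime_pow_dvd hp V k g (hV _) (hV _)
  have h2 := character_pow_prime_pow_dvd hp V k h (hV _) (hV _)
  have : a g - a h = (a g - a (g ^ p ^ k)) - (a h - a (h ^ p ^ k)) := by rw [h3]; ring
  rw [this]
  exact dvd_sub h1 h2

theorem sum_mul (ha : IsIrreducibleIntCharacter a) (hb : IsIrreducibleIntCharacter b) :
    ∑ g, a g * b g = if a = b then (Nat.factorial N : ℤ) else 0 := by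
  have hbinv : ∀ g, b g⁻¹ = b g := fun g =>
    hb.eq_of_isConj (by rw [Equiv.Perm.isConj_iff_cycleType_eq, Equiv.Perm.cycleType_inv])
  obtain ⟨V, hVs, hV⟩ := ha
  obtain ⟨W, hWs, hW⟩ := hb
  have hc : (Nat.card (Equiv.Perm (Fin N)) : ℂ) = (N.factorial : ℂ) := by
    rw [Nat.card_eq_fintype_card, Fintype.card_perm, Fintype.card_fin]
  have hc0 : ((N.factorial : ℕ) : ℂ) ≠ 0 := by exact_mod_cast N.factorial_ne_zero
  by_cases hab : a = b
  · subst hab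
    have h1 := FDRep.char_orthonormal V V
    simp_rw [hV, hbinv] at h1
    rw [hc, inv_mul_eq_iff_eq_mul₀ hc0, if_pos ⟨CategoryTheory.Iso.refl V⟩, mul_one] at h1
    rw [if_pos rfl]
    exact_mod_cast h1
  · have hni : ¬ Nonempty (V ≅ W) := by
      rintro ⟨i⟩
      apply hab
      ext g
      have := congrFun (FDRep.char_iso i) g
      rw [hV, hW] at this
      exact_mod_cast this
    have h1 := FDRep.char_orthonormal V W
    simp_rw [hV, hW, hbinv] at h1
    rw [hc, inv_mul_eq_iff_eq_mul₀ hc0, if_neg hni, mul_zero] at h1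
    rw [if_neg hab]
    exact_mod_cast h1

/-- The Bessel inequality for the indicator function of a conjugacy class. -/
theorem card_mul_sum_sq_le (F : Finset (Equiv.Perm (Fin N) → ℤ))
    (hF : ∀ a ∈ F, IsIrreducibleIntCharacter a) (K : Finset (Equiv.Perm (Fin N)))
    {g : Equiv.Perm (Fin N)} (hg : g ∈ K) (hK : ∀ h ∈ K, IsConj g h) :
    (K.card : ℤ) * ∑ a ∈ F, a g ^ 2 ≤ N.factorial := by
  classical
  set n : ℤ := ((N.factorial : ℕ) : ℤ) with hn_def
  set k : ℤ := (K.card : ℤ) with hk_def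
  have hk : 0 < k := by
    have : 0 < K.card := Finset.card_pos.2 ⟨g, hg⟩
    rw [hk_def]; exact_mod_cast this
  have hn : 0 < n := by rw [hn_def]; exact_mod_cast N.factorial_pos
  set S := ∑ a ∈ F, a g ^ 2
  set f : Equiv.Perm (Fin N) → ℤ := fun x => ∑ a ∈ F, a g * a x with hf
  have e1 : ∑ x ∈ K, f x = k * S := by
    have : ∀ x ∈ K, f x = S := by
      intro x hx
      refine Finset.sum_congr rfl fun a ha => ?_
      rw [← (hF a ha).eq_of_isConj (hK x hx), sq]
    rw [Finset.sum_congr rfl this]; simp [k]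
  have e2 : ∑ x, f x ^ 2 = n * S := by
    simp_rw [hf, sq, Finset.sum_mul_sum]
    rw [Finset.sum_comm]
    rw [Finset.mul_sum]
    refine Finset.sum_congr rfl fun a ha => ?_
    rw [Finset.sum_comm]
    have : ∀ b ∈ F, ∑ y, a g * a y * (b g * b y) = if a = b then n * (a g * a g) else 0 := by
      intro b hb
      have h1 : ∀ y, a g * a y * (b g * b y) = a g * b g * (a y * b y) := fun y => by ring
      simp_rw [h1]
      rw [← Finset.mul_sum, (hF a ha).sum_mul (hF b hb)]
      split_ifs with h
      · rw [← h]; ring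
      · ring
    rw [Finset.sum_congr rfl this, Finset.sum_ite_eq, if_pos ha, sq]
  have e3 : 0 ≤ ∑ x, ((if x ∈ K then n else 0) - k * f x) ^ 2 :=
    Finset.sum_nonneg fun _ _ => sq_nonneg _
  have e4 : ∑ x, ((if x ∈ K then n else 0) - k * f x) ^ 2 =
      n ^ 2 * k - 2 * n * k * (k * S) + k ^ 2 * (n * S) := by
    rw [← e1, ← e2]
    have h1 : ∀ x, ((if x ∈ K then n else 0) - k * f x) ^ 2 =
        (if x ∈ K then n ^ 2 else 0) - 2 * n * k * (if x ∈ K then f x else 0) +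
          k ^ 2 * f x ^ 2 := by
      intro x
      split_ifs <;> ring
    simp_rw [h1]
    rw [Finset.sum_add_distrib, Finset.sum_sub_distrib, ← Finset.mul_sum, ← Finset.mul_sum]
    simp [Finset.sum_ite_mem, k]
    ring
  rw [e4] at e3
  have e5 : 0 ≤ n * k * (n - k * S) := by linarith
  have e6 := nonneg_of_mul_nonneg_right e5 (mul_pos hn hk)
  linarith

end IsIrreducibleIntCharacter

namespace Equiv.Perm

theorem card_isConj_mul_card_centralizer {α : Type*} [Fintype α] [DecidableEq α]
    (g : Equiv.Perm α) :
    (Finset.univ.filter fun h => IsConj g h).card * Nat.card (Subgroup.centralizer {g}) =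
      (Fintype.card α).factorial := by
  rw [nat_card_centralizer, ← card_isConj_mul_eq g]
  congr 1
  rw [Nat.card_eq_fintype_card, Fintype.card_subtype]
  rfl

theorem sum_card_centralizer_mul_le {α : Type*} [Fintype α] [DecidableEq α]
    (f : (Fintype.card α).Partition → ℕ) :
    ∑ h : Equiv.Perm α, Nat.card (Subgroup.centralizer {h}) * f h.partition ≤
      (Fintype.card α).factorial * ∑ π, f π := by
  rw [← Finset.sum_fiberwise Finset.univ Equiv.Perm.partition, Finset.mul_sum]
  refine Finset.sum_le_sum fun π _ => ?_
  rcases (Finset.univ.filter fun h : Equiv.Perm α => h.partition = π).eq_empty_or_nonempty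
    with h0 | ⟨g, hg⟩
  · rw [h0]; simp
  · rw [Finset.mem_filter] at hg
    have h1 : (Finset.univ.filter fun h : Equiv.Perm α => h.partition = π) =
        Finset.univ.filter fun h => IsConj g h := by
      ext h
      rw [Finset.mem_filter, Finset.mem_filter, partition_eq_of_isConj, hg.2]
      simp only [Finset.mem_univ, true_and, eq_comm]
    have h2 : ∀ h ∈ Finset.univ.filter fun h : Equiv.Perm α => h.partition = π,
        Nat.card (Subgroup.centralizer {h}) * f h.partition =
        Nat.card (Subgroup.centralizer {g}) * f π := by
      intro h hh
      rw [Finset.mem_filter] at hh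
      have : g.cycleType = h.cycleType := by
        rw [← isConj_iff_cycleType_eq, partition_eq_of_isConj, hg.2, hh.2]
      rw [hh.2, nat_card_centralizer, nat_card_centralizer, this]
    rw [Finset.sum_congr rfl h2, Finset.sum_const, smul_eq_mul, h1, ← mul_assoc,
      card_isConj_mul_card_centralizer]

theorem card_centralizer_ofSubtype_mul {α : Type*} [Fintype α] [DecidableEq α]
    (g : Equiv.Perm α) (hg : g.cycleType.Nodup) (h : Equiv.Perm {x // x ∉ g.support}) :
    Nat.card (Subgroup.centralizer {ofSubtype h * g}) =
      Nat.card (Subgroup.centralizer {h}) *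
        (g.cycleType.map fun M => M * (h.cycleType.count M + 1)).prod := by
  have hd : Disjoint (ofSubtype h) g := by
    intro x
    by_cases hx : x ∈ g.support
    · exact Or.inl (ofSubtype_apply_of_not_mem h (by simpa using hx))
    · exact Or.inr (by simpa using hx)
  have hct : (ofSubtype h * g).cycleType = h.cycleType + g.cycleType := by
    rw [hd.cycleType_mul, cycleType_ofSubtype]
  have hcard : Fintype.card {x // x ∉ g.support} = Fintype.card α - g.cycleType.sum := by
    rw [sum_cycleType, Fintype.card_subtype_compl, Fintype.card_coe]
  rw [nat_card_centralizer, nat_card_centralizer, hct, Multiset.sum_add, Multiset.prod_add, hcard,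
    Multiset.prod_map_mul, Multiset.map_id']
  have h1 : Fintype.card α - (h.cycleType.sum + g.cycleType.sum) =
      Fintype.card α - g.cycleType.sum - h.cycleType.sum := by omega
  have h2 : ∏ n ∈ (h.cycleType + g.cycleType).toFinset,
      ((h.cycleType + g.cycleType).count n).factorial =
      (∏ n ∈ h.cycleType.toFinset, (h.cycleType.count n).factorial) *
        (g.cycleType.map fun M => h.cycleType.count M + 1).prod := by
    have h3 : ∏ n ∈ h.cycleType.toFinset, (h.cycleType.count n).factorial =
        ∏ n ∈ (h.cycleType + g.cycleType).toFinset, (h.cycleType.count n).factorial := by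
      refine Finset.prod_subset (by rw [Multiset.toFinset_add]; exact Finset.subset_union_left) ?_
      intro x _ hx
      rw [Multiset.mem_toFinset] at hx
      rw [Multiset.count_eq_zero_of_notMem hx, Nat.factorial_zero]
    have h4 : (g.cycleType.map fun M => h.cycleType.count M + 1).prod =
        ∏ n ∈ (h.cycleType + g.cycleType).toFinset,
          if n ∈ g.cycleType then h.cycleType.count n + 1 else 1 := by
      rw [← Finset.prod_filter]
      have : Finset.filter (· ∈ g.cycleType) (h.cycleType + g.cycleType).toFinset =
          g.cycleType.toFinset := by
        ext x
        simp only [Finset.mem_filter, Multiset.mem_toFinset, Multiset.mem_add]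
        tauto
      rw [this, Finset.prod_multiset_map_count]
      refine Finset.prod_congr rfl fun x hx => ?_
      rw [Multiset.count_eq_one_of_mem hg (by simpa using hx), pow_one]
    rw [h3, h4, ← Finset.prod_mul_distrib]
    refine Finset.prod_congr rfl fun x _ => ?_
    rw [Multiset.count_add]
    split_ifs with hx
    · rw [Multiset.count_eq_one_of_mem hg hx, Nat.factorial_succ, mul_comm]
    · rw [Multiset.count_eq_zero_of_notMem hx, add_zero, mul_one]
  rw [h1, h2]
  ring

end Equiv.Perm

namespace IsIrreducibleIntCharacter
variable {N : ℕ}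

theorem sum_sq_le_card_centralizer (F : Finset (Equiv.Perm (Fin N) → ℤ))
    (hF : ∀ a ∈ F, IsIrreducibleIntCharacter a) (g : Equiv.Perm (Fin N)) :
    ∑ a ∈ F, a g ^ 2 ≤ Nat.card (Subgroup.centralizer {g}) := by
  have h1 := card_mul_sum_sq_le F hF (Finset.univ.filter fun h => IsConj g h) (g := g)
    (Finset.mem_filter.2 ⟨Finset.mem_univ _, IsConj.refl g⟩) fun h hh => (Finset.mem_filter.1 hh).2
  have h2 := Equiv.Perm.card_isConj_mul_card_centralizer g
  rw [Fintype.card_fin] at h2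
  rw [← h2, Nat.cast_mul] at h1
  refine le_of_mul_le_mul_left h1 ?_
  have : 0 < (Finset.univ.filter fun h => IsConj g h).card := 
    Finset.card_pos.2 ⟨g, Finset.mem_filter.2 ⟨Finset.mem_univ _, IsConj.refl g⟩⟩
  exact_mod_cast this

theorem card_le_card_partition (F : Finset (Equiv.Perm (Fin N) → ℤ))
    (hF : ∀ a ∈ F, IsIrreducibleIntCharacter a) : F.card ≤ Fintype.card N.Partition := by
  have h1 : ((F.card * N.factorial : ℕ) : ℤ) ≤
      ((N.factorial * Fintype.card N.Partition : ℕ) : ℤ) := by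
    calc ((F.card * N.factorial : ℕ) : ℤ) = ∑ a ∈ F, ∑ g, a g ^ 2 := by
          have : ∀ a ∈ F, ∑ g, a g ^ 2 = (N.factorial : ℤ) := by
            intro a ha
            have := (hF a ha).sum_mul (hF a ha)
            rw [if_pos rfl] at this
            simpa [sq] using this
          rw [Finset.sum_congr rfl this]; simp
      _ = ∑ g, ∑ a ∈ F, a g ^ 2 := Finset.sum_comm
      _ ≤ ∑ g : Equiv.Perm (Fin N), (Nat.card (Subgroup.centralizer {g}) : ℤ) :=
          Finset.sum_le_sum fun g _ => sum_sq_le_card_centralizer F hF g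
      _ ≤ _ := by
          have := Equiv.Perm.sum_card_centralizer_mul_le (α := Fin N) fun _ => 1
          rw [Fintype.card_fin] at this
          simp only [mul_one, Finset.sum_const, Finset.card_univ, smul_eq_mul] at this
          exact_mod_cast this
  have h2 : F.card * N.factorial ≤ N.factorial * Fintype.card N.Partition := by exact_mod_cast h1
  rw [mul_comm] at h2
  exact Nat.le_of_mul_le_mul_left h2 N.factorial_pos

theorem card_filter_ne_zero_le (F : Finset (Equiv.Perm (Fin N) → ℤ))
    (hF : ∀ a ∈ F, IsIrreducibleIntCharacter a) {g : Equiv.Perm (Fin N)} {Ms : Multiset ℕ}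
    (hnd : Ms.Nodup) (hle : Ms ≤ g.cycleType) :
    (F.filter fun a => a g ≠ 0).card ≤
      ∑ π : (N - Ms.sum).Partition, (Ms.map fun M => M * (π.parts.count M + 1)).prod := by
  have hsum : g.cycleType.sum ≤ N := by
    simpa [Equiv.Perm.sum_cycleType] using Finset.card_le_univ g.support
  obtain ⟨R, hR⟩ := Multiset.le_iff_exists_add.1 hle
  rw [hR, Multiset.sum_add] at hsum
  have h2 : ∀ x ∈ g.cycleType, 2 ≤ x := fun x => Equiv.Perm.two_le_of_mem_cycleType
  rw [hR] at h2
  obtain ⟨g0, hg0⟩ := (Equiv.Perm.exists_with_cycleType_iff (Fin N) (m := Ms)).2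
    ⟨by rw [Fintype.card_fin]; omega, fun a ha => h2 a (by simp [ha])⟩
  have hcard : Fintype.card {x // x ∉ g0.support} = N - Ms.sum := by
    rw [← hg0, Equiv.Perm.sum_cycleType, Fintype.card_subtype_compl, Fintype.card_coe,
      Fintype.card_fin]
  obtain ⟨h0, hh0⟩ := (Equiv.Perm.exists_with_cycleType_iff {x // x ∉ g0.support} (m := R)).2
    ⟨by rw [hcard]; omega, fun a ha => h2 a (by simp [ha])⟩
  have hd : ∀ h : Equiv.Perm {x // x ∉ g0.support},
      Equiv.Perm.Disjoint (Equiv.Perm.ofSubtype h) g0 := by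
    intro h x
    by_cases hx : x ∈ g0.support
    · exact Or.inl (Equiv.Perm.ofSubtype_apply_of_not_mem h (by simpa using hx))
    · exact Or.inr (by simpa using hx)
  have hconj : IsConj g (Equiv.Perm.ofSubtype h0 * g0) := by
    rw [Equiv.Perm.isConj_iff_cycleType_eq, (hd h0).cycleType_mul,
      Equiv.Perm.cycleType_ofSubtype, hg0, hh0, hR, add_comm]
  have hcount : ∀ h : Equiv.Perm {x // x ∉ g0.support}, ∀ M ∈ Ms,
      h.cycleType.count M = h.partition.parts.count M := by
    intro h M hM
    rw [Equiv.Perm.parts_partition, Multiset.count_add, Multiset.count_replicate, if_neg, add_zero]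
    have := h2 M (by simp [hM])
    omega
  set F' := F.filter fun a => a g ≠ 0
  have key : ((F'.card * (Fintype.card {x // x ∉ g0.support}).factorial : ℕ) : ℤ) ≤
      (((Fintype.card {x // x ∉ g0.support}).factorial *
        ∑ π : (Fintype.card {x // x ∉ g0.support}).Partition,
          (Ms.map fun M => M * (π.parts.count M + 1)).prod : ℕ) : ℤ) := by
    calc ((F'.card * (Fintype.card {x // x ∉ g0.support}).factorial : ℕ) : ℤ)
        = ∑ a ∈ F', (Fintype.card (Equiv.Perm {x // x ∉ g0.support}) : ℤ) := by
          rw [Fintype.card_perm]; simp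
      _ ≤ ∑ a ∈ F', ∑ h, a (Equiv.Perm.ofSubtype h * g0) ^ 2 := by
          refine Finset.sum_le_sum fun a ha => ?_
          rw [Finset.mem_filter] at ha
          refine (hF a ha.1).card_le_sum_sq Equiv.Perm.ofSubtype (fun h => (hd h).commute)
            ⟨h0, ?_⟩
          rw [← (hF a ha.1).eq_of_isConj hconj]
          exact ha.2
      _ = ∑ h, ∑ a ∈ F', a (Equiv.Perm.ofSubtype h * g0) ^ 2 := Finset.sum_comm
      _ ≤ ∑ h, (Nat.card (Subgroup.centralizer {Equiv.Perm.ofSubtype h * g0}) : ℤ) :=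
          Finset.sum_le_sum fun h _ => sum_sq_le_card_centralizer F'
            (fun a ha => hF a (Finset.mem_filter.1 ha).1) _
      _ ≤ _ := by
          rw [← Nat.cast_sum]
          refine Nat.cast_le.2 (le_trans (le_of_eq ?_) (Equiv.Perm.sum_card_centralizer_mul_le _))
          refine Finset.sum_congr rfl fun h _ => ?_
          rw [Equiv.Perm.card_centralizer_ofSubtype_mul g0 (by rwa [hg0]), hg0]
          congr 2
          exact Multiset.map_congr rfl fun M hM => by rw [hcount h M hM]
  rw [hcard] at key
  have h3 := Nat.cast_le.1 key
  rw [mul_comm] at h3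
  exact Nat.le_of_mul_le_mul_left h3 (Nat.factorial_pos _)

end IsIrreducibleIntCharacter

/-- Replace every part `l` of a multiset by `p ^ v` parts `l / p ^ v`, where `v` is the `p`-adic
valuation of `l`. -/
def Multiset.regularize (p : ℕ) (s : Multiset ℕ) : Multiset ℕ :=
  s.bind fun l => Multiset.replicate (ordProj[p] l) (ordCompl[p] l)

namespace Multiset

theorem regularize_add (p : ℕ) (s t : Multiset ℕ) :
    (s + t).regularize p = s.regularize p + t.regularize p :=
  Multiset.add_bind _ _ _

theorem sum_regularize (p : ℕ) (s : Multiset ℕ) : (s.regularize p).sum = s.sum := by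
  induction s using Multiset.induction_on with
  | empty => rfl
  | cons a s ih =>
    rw [← Multiset.singleton_add, regularize_add, Multiset.sum_add, Multiset.sum_add, ih]
    congr 1
    simp [regularize, Nat.ordProj_mul_ordCompl_eq_self]

theorem regularize_eq_replicate {p d : ℕ} (hd : 0 < d) {s : Multiset ℕ}
    (h : ∀ l ∈ s, ordCompl[p] l = d) : s.regularize p = replicate (s.sum / d) d := by
  have h1 : ∀ x ∈ s.regularize p, x = d := by
    intro x hx
    obtain ⟨l, hl, hx⟩ := Multiset.mem_bind.1 hx
    rw [Multiset.eq_of_mem_replicate hx, h l hl]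
  have h2 := Multiset.eq_replicate_card.2 h1
  have h3 := sum_regularize p s
  rw [h2, Multiset.sum_replicate, smul_eq_mul] at h3
  rw [← h3, Nat.mul_div_cancel _ hd]
  exact h2

theorem exists_regularize_eq_of_le_sum {p : ℕ} (hp : p.Prime) {j k : ℕ} (hj : 0 < j)
    {s : Multiset ℕ} (hs : ∀ l ∈ s, ∃ i < k, l = j * p ^ i) (hsum : j * p ^ k ≤ s.sum) :
    ∃ t : Multiset ℕ, j * p ^ k ∈ t ∧ t.regularize p = s.regularize p := by
  have hd : 0 < ordCompl[p] j := Nat.ordCompl_pos p hj.ne'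
  have hcompl : ∀ i, ordCompl[p] (j * p ^ i) = ordCompl[p] j := by
    intro i
    rw [Nat.ordCompl_mul, Nat.ordCompl_self_pow hp, mul_one]
  have hdvd : j ∣ s.sum := Multiset.dvd_sum fun l hl => by
    obtain ⟨i, -, rfl⟩ := hs l hl
    exact Dvd.intro _ rfl
  obtain ⟨T, hT⟩ := hdvd
  refine ⟨{j * p ^ k} + replicate (T - p ^ k) j, by simp, ?_⟩
  rw [regularize_eq_replicate hd, regularize_eq_replicate hd]
  · rw [Multiset.sum_add, Multiset.sum_singleton, Multiset.sum_replicate, smul_eq_mul]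
    rw [hT] at hsum ⊢
    have h1 : p ^ k ≤ T := Nat.le_of_mul_le_mul_left hsum hj
    rw [mul_comm (T - p ^ k), ← Nat.mul_add, Nat.add_sub_cancel' h1]
  · intro l hl
    obtain ⟨i, -, rfl⟩ := hs l hl
    exact hcompl i
  · intro l hl
    rw [Multiset.mem_add, Multiset.mem_singleton] at hl
    rcases hl with rfl | hl
    · exact hcompl k
    · rw [Multiset.eq_of_mem_replicate hl]

theorem exists_regularize_eq_of_forall_le_sum {p : ℕ} (hp : p.Prime) {k : ℕ} (S : Finset ℕ)
    (hpos : ∀ j ∈ S, 0 < j)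
    (hdisj : ∀ j ∈ S, ∀ j' ∈ S, j ≠ j' → ∀ i < k, ∀ i' < k, j * p ^ i ≠ j' * p ^ i')
    (s : Multiset ℕ)
    (hs : ∀ j ∈ S, j * p ^ k ≤ (s.filter fun l => ∃ i < k, l = j * p ^ i).sum) :
    ∃ t : Multiset ℕ, S.val.map (· * p ^ k) ≤ t ∧ t.regularize p = s.regularize p := by
  induction S using Finset.induction_on generalizing s with
  | empty => exact ⟨s, by simp, rfl⟩
  | insert j S hjS ih =>
    set A := s.filter fun l => ∃ i < k, l = j * p ^ i with hA
    set B := s.filter fun l => ¬ ∃ i < k, l = j * p ^ i with hB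
    have hAB : A + B = s := Multiset.filter_add_not _ _
    obtain ⟨A', hA1, hA2⟩ := exists_regularize_eq_of_le_sum hp (hpos j (by simp)) (s := A) (k := k)
      (fun l hl => (Multiset.mem_filter.1 hl).2) (hs j (by simp))
    obtain ⟨B', hB1, hB2⟩ := ih (fun j' hj' => hpos j' (by simp [hj']))
      (fun j1 h1 j2 h2 => hdisj j1 (by simp [h1]) j2 (by simp [h2])) B (by
        intro j' hj'
        convert hs j' (by simp [hj']) using 2
        rw [hB, Multiset.filter_filter]
        refine Multiset.filter_congr fun l _ => ?_
        constructor
        · exact fun h => h.1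
        · refine fun h => ⟨h, ?_⟩
          rintro ⟨i, hi, rfl⟩
          obtain ⟨i', hi', h'⟩ := h
          exact hdisj j (by simp) j' (by simp [hj']) (fun h => hjS (h ▸ hj')) i hi i' hi' h')
    refine ⟨A' + B', ?_, ?_⟩
    · rw [Finset.insert_val_of_notMem hjS, Multiset.map_cons, ← Multiset.singleton_add]
      exact add_le_add (Multiset.singleton_le.2 hA1) hB1
    · rw [regularize_add, hA2, hB2, ← regularize_add, hAB]

end Multiset

theorem Nat.gcd_prime_pow_eq_ordProj {p : ℕ} (hp : p.Prime) {l K : ℕ} (hl : 0 < l) (hK : l ≤ K) :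
    l.gcd (p ^ K) = ordProj[p] l := by
  have h1 : l.factorization p ≤ K := (Nat.factorization_lt p hl.ne').le.trans hK
  apply Nat.dvd_antisymm
  · obtain ⟨i, -, hi⟩ := (Nat.dvd_prime_pow hp).1 (Nat.gcd_dvd_right l (p ^ K))
    rw [hi]
    have : p ^ i ∣ l := hi ▸ Nat.gcd_dvd_left _ _
    exact Nat.pow_dvd_pow _ ((hp.pow_dvd_iff_le_factorization hl.ne').1 this)
  · exact Nat.dvd_gcd (Nat.ordProj_dvd l p) (Nat.pow_dvd_pow _ h1)

theorem Equiv.Perm.cycleType_pow_prime_pow {α : Type*} [Fintype α] [DecidableEq α]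
    (g : Equiv.Perm α) {p K : ℕ} (hp : p.Prime) {s : Multiset ℕ}
    (hs : g.cycleType = s.filter (2 ≤ ·)) (hK : Fintype.card α ≤ K) :
    (g ^ p ^ K).cycleType = (s.regularize p).filter (2 ≤ ·) := by
  rw [Equiv.Perm.cycleType_pow_eq]
  have h1 : (g.cycleType.bind fun l => Multiset.replicate (l.gcd (p ^ K)) (l / l.gcd (p ^ K))) =
      g.cycleType.regularize p := by
    refine Multiset.bind_congr fun l hl => ?_
    have h2 : 2 ≤ l := Equiv.Perm.two_le_of_mem_cycleType hl
    have h3 : l ≤ Fintype.card α :=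
      (Multiset.le_sum_of_mem hl).trans (by rw [sum_cycleType]; exact Finset.card_le_univ _)
    rw [Nat.gcd_prime_pow_eq_ordProj hp (by omega) (h3.trans hK)]
  rw [h1, hs]
  conv_rhs => rw [← Multiset.filter_add_not (2 ≤ ·) s, Multiset.regularize_add,
    Multiset.filter_add]
  rw [left_eq_add, Multiset.filter_eq_nil]
  intro x hx
  obtain ⟨l, hl, hx⟩ := Multiset.mem_bind.1 hx
  have := (Multiset.mem_filter.1 hl).2
  rw [Multiset.eq_of_mem_replicate hx]
  have := Nat.ordCompl_le l p
  omega

namespace IsIrreducibleIntCharacter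
variable {N : ℕ}

theorem card_filter_not_dvd_le (F : Finset (Equiv.Perm (Fin N) → ℤ))
    (hF : ∀ a ∈ F, IsIrreducibleIntCharacter a) (g : Equiv.Perm (Fin N)) {s : Multiset ℕ}
    (hg : g.cycleType = s.filter (2 ≤ ·)) (hsum : s.sum = N) {p : ℕ} (hp : p.Prime) {k : ℕ}
    (hk : 1 ≤ k) (S : Finset ℕ) (hpos : ∀ j ∈ S, 0 < j)
    (hdisj : ∀ j ∈ S, ∀ j' ∈ S, j ≠ j' → ∀ i < k, ∀ i' < k, j * p ^ i ≠ j' * p ^ i')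
    (hs : ∀ j ∈ S, j * p ^ k ≤ (s.filter fun l => ∃ i < k, l = j * p ^ i).sum) :
    ∑ j ∈ S, j * p ^ k ≤ N ∧ (F.filter fun a => ¬ (p : ℤ) ∣ a g).card ≤
      ∑ π : (N - ∑ j ∈ S, j * p ^ k).Partition,
        ∏ j ∈ S, (j * p ^ k * (π.parts.count (j * p ^ k) + 1)) := by
  obtain ⟨t, ht1, ht2⟩ := Multiset.exists_regularize_eq_of_forall_le_sum hp S hpos hdisj s hs
  have htsum : t.sum = N := by rw [← Multiset.sum_regularize p, ht2, Multiset.sum_regularize, hsum]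
  obtain ⟨g', hg'⟩ := (Equiv.Perm.exists_with_cycleType_iff (Fin N) (m := t.filter (2 ≤ ·))).2
    ⟨by
      rw [Fintype.card_fin, ← htsum]
      conv_rhs => rw [← Multiset.filter_add_not (2 ≤ ·) t, Multiset.sum_add]
      exact Nat.le_add_right _ _, fun a ha => (Multiset.mem_filter.1 ha).2⟩
  have hconj : IsConj (g ^ p ^ N) (g' ^ p ^ N) := by
    rw [Equiv.Perm.isConj_iff_cycleType_eq, g.cycleType_pow_prime_pow hp hg (by simp),
      g'.cycleType_pow_prime_pow hp hg' (by simp), ht2]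
  have hpk : 2 ≤ p ^ k := hp.two_le.trans (Nat.le_self_pow (by omega) p)
  have hnd : (S.val.map (· * p ^ k)).Nodup :=
    S.nodup.map fun a b hab => Nat.eq_of_mul_eq_mul_right (by omega) hab
  have hle : S.val.map (· * p ^ k) ≤ g'.cycleType := by
    rw [hg']
    refine Multiset.le_filter.2 ⟨ht1, ?_⟩
    intro x hx
    obtain ⟨j, hj, rfl⟩ := Multiset.mem_map.1 hx
    have := hpos j hj
    nlinarith
  have h1 := card_filter_ne_zero_le F hF hnd hle
  rw [show (S.val.map (· * p ^ k)).sum = ∑ j ∈ S, j * p ^ k from rfl] at h1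
  have h2 : ∑ j ∈ S, j * p ^ k ≤ N := by
    have h3 : (S.val.map (· * p ^ k)).sum ≤ g'.cycleType.sum := by
      obtain ⟨u, hu⟩ := Multiset.le_iff_exists_add.1 hle
      rw [hu, Multiset.sum_add]
      exact Nat.le_add_right _ _
    refine h3.trans ?_
    simpa [Equiv.Perm.sum_cycleType] using Finset.card_le_univ g'.support
  refine ⟨h2, ?_⟩
  refine (Finset.card_le_card ?_).trans (h1.trans (le_of_eq ?_))
  · intro a ha
    rw [Finset.mem_filter] at ha ⊢
    refine ⟨ha.1, fun h0 => ha.2 ?_⟩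
    have := (hF a ha.1).dvd_sub_of_isConj_pow hp hconj
    rwa [h0, sub_zero] at this
  · refine Finset.sum_congr rfl fun π _ => ?_
    rw [Multiset.map_map]
    rfl

end IsIrreducibleIntCharacter

theorem IsIrreducibleIntCharacter.finite (N : ℕ) :
    {a : Equiv.Perm (Fin N) → ℤ | IsIrreducibleIntCharacter a}.Finite := by
  by_contra h
  obtain ⟨F, hF, hc⟩ := Set.Infinite.exists_subset_card_eq h (Fintype.card N.Partition + 1)
  have := card_le_card_partition F fun a ha => hF ha
  omega

theorem ConjClasses.exists_injective_partition (N : ℕ) :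
    ∃ f : ConjClasses (Equiv.Perm (Fin N)) → N.Partition, Function.Injective f ∧
      ∀ c, c.out.cycleType = (f c).parts.filter (2 ≤ ·) := by
  refine ⟨fun c => ⟨c.out.partition.parts, c.out.partition.parts_pos, by
    rw [c.out.partition.parts_sum, Fintype.card_fin]⟩, ?_, ?_⟩
  · intro c d hcd
    have h1 : c.out.partition.parts = d.out.partition.parts :=
      congrArg (fun π : N.Partition => π.parts) hcd
    rw [← Quotient.out_eq c, ← Quotient.out_eq d]
    exact Quotient.sound (Equiv.Perm.partition_eq_of_isConj.2 (Nat.Partition.ext h1))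
  · intro c
    exact Equiv.Perm.filter_parts_partition_eq_cycleType.symm

theorem ncard_not_dvd_le {N : ℕ} (P : Finset ℕ) (hP : ∀ p ∈ P, p.Prime)
    (B : ℕ → Finset N.Partition) (E : ℕ → ℝ) (hE : ∀ p ∈ P, 0 ≤ E p)
    (h : ∀ p ∈ P, ∀ F : Finset (Equiv.Perm (Fin N) → ℤ), (∀ a ∈ F, IsIrreducibleIntCharacter a) →
      ∀ (g : Equiv.Perm (Fin N)) (π : N.Partition), g.cycleType = π.parts.filter (2 ≤ ·) →
        π ∉ B p → ((F.filter fun a => ¬ (p : ℤ) ∣ a g).card : ℝ) ≤ E p) :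
    (Set.ncard {χc : (Equiv.Perm (Fin N) → ℂ) × ConjClasses (Equiv.Perm (Fin N)) |
          (∃ V : FDRep ℂ (Equiv.Perm (Fin N)), Simple V ∧ χc.1 = V.character) ∧
          ∀ g : Equiv.Perm (Fin N), ConjClasses.mk g = χc.2 →
            ¬ ∃ m : ℤ, χc.1 g = ((∏ q ∈ P, q : ℕ) : ℂ) * (m : ℂ)} : ℝ) ≤
      ∑ p ∈ P, (((B p).card : ℝ) * Fintype.card N.Partition + Fintype.card N.Partition * E p) := by
  classical
  set F := (IsIrreducibleIntCharacter.finite N).toFinset with hFdef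
  have hF : ∀ a ∈ F, IsIrreducibleIntCharacter a := fun a ha => by simpa [hFdef] using ha
  obtain ⟨f, hf, hfc⟩ := ConjClasses.exists_injective_partition N
  have := Fintype.ofFinite (ConjClasses (Equiv.Perm (Fin N)))
  set Q : ℕ → Finset ((Equiv.Perm (Fin N) → ℤ) × ConjClasses (Equiv.Perm (Fin N))) := fun p =>
    (F ×ˢ Finset.univ).filter fun x => ¬ (p : ℤ) ∣ x.1 x.2.out with hQ
  have hsub : {χc : (Equiv.Perm (Fin N) → ℂ) × ConjClasses (Equiv.Perm (Fin N)) |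
          (∃ V : FDRep ℂ (Equiv.Perm (Fin N)), Simple V ∧ χc.1 = V.character) ∧
          ∀ g : Equiv.Perm (Fin N), ConjClasses.mk g = χc.2 →
            ¬ ∃ m : ℤ, χc.1 g = ((∏ q ∈ P, q : ℕ) : ℂ) * (m : ℂ)} ⊆
      (((P.biUnion Q).image fun x => ((fun g => (x.1 g : ℂ)), x.2) : Finset _) : Set _) := by
    rintro ⟨χ, c⟩ ⟨⟨V, hVs, rfl⟩, hbad⟩
    choose a ha using exists_int_character V
    have hirr : IsIrreducibleIntCharacter a := ⟨V, hVs, ha⟩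
    have h1 := hbad c.out (Quotient.out_eq c)
    have h2 : ∃ p ∈ P, ¬ (p : ℤ) ∣ a c.out := by
      by_contra hcon
      push Not at hcon
      apply h1
      have h3 : ∏ q ∈ P, (q : ℤ) ∣ a c.out := by
        refine Finset.prod_dvd_of_coprime ?_ hcon
        intro p hp q hq hpq
        exact Nat.isCoprime_iff_coprime.2 ((Nat.coprime_primes (hP p hp) (hP q hq)).2 hpq)
      obtain ⟨m, hm⟩ := h3
      refine ⟨m, ?_⟩
      simp only [ha, hm]
      push_cast
      rfl
    obtain ⟨p, hp, hdvd⟩ := h2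
    rw [Finset.mem_coe, Finset.mem_image]
    refine ⟨(a, c), Finset.mem_biUnion.2 ⟨p, hp, ?_⟩, ?_⟩
    · simp [hQ, hFdef, hirr, hdvd]
    · ext1
      · funext g; exact (ha g).symm
      · rfl
  have hcard1 := Set.ncard_le_ncard hsub (Finset.finite_toSet _)
  rw [Set.ncard_coe_finset] at hcard1
  have hcard2 := hcard1.trans (Finset.card_image_le.trans Finset.card_biUnion_le)
  have hQle : ∀ p ∈ P, ((Q p).card : ℝ) ≤
      ((B p).card : ℝ) * Fintype.card N.Partition + Fintype.card N.Partition * E p := by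
    intro p hp
    have e1 : (Q p).card = ∑ c : ConjClasses (Equiv.Perm (Fin N)),
        (F.filter fun a => ¬ (p : ℤ) ∣ a c.out).card := by
      rw [hQ, Finset.card_filter, Finset.sum_product_right]
      refine Finset.sum_congr rfl fun c _ => ?_
      rw [Finset.card_filter]
    have e2 : ∀ c : ConjClasses (Equiv.Perm (Fin N)),
        ((F.filter fun a => ¬ (p : ℤ) ∣ a c.out).card : ℝ) ≤
          (if f c ∈ B p then (Fintype.card N.Partition : ℝ) else 0) + E p := by
      intro c
      split_ifs with hc
      · have h1 : ((F.filter fun a => ¬ (p : ℤ) ∣ a c.out).card : ℝ) ≤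
            Fintype.card N.Partition := by
          exact_mod_cast (Finset.card_filter_le _ _).trans
            (IsIrreducibleIntCharacter.card_le_card_partition F hF)
        have := hE p hp
        linarith
      · rw [zero_add]
        exact h p hp F hF _ _ (hfc c) hc
    rw [e1, Nat.cast_sum]
    refine (Finset.sum_le_sum fun c _ => e2 c).trans ?_
    have e3 : ∑ c, ((if f c ∈ B p then (Fintype.card N.Partition : ℝ) else 0) + E p) =
        ∑ π ∈ Finset.univ.map ⟨f, hf⟩,
          ((if π ∈ B p then (Fintype.card N.Partition : ℝ) else 0) + E p) := by
      rw [Finset.sum_map]; rfl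
    rw [e3]
    refine (Finset.sum_le_univ_sum_of_nonneg fun π => ?_).trans (le_of_eq ?_)
    · have := hE p hp
      positivity
    · rw [Finset.sum_add_distrib, Finset.sum_ite_mem, Finset.univ_inter]
      simp
  calc _ ≤ ((∑ p ∈ P, (Q p).card : ℕ) : ℝ) := by exact_mod_cast hcard2
    _ = ∑ p ∈ P, ((Q p).card : ℝ) := by push_cast; rfl
    _ ≤ _ := Finset.sum_le_sum hQle

namespace Nat.Partition

theorem eq_of_forall_count_eq {n : ℕ} {π ρ : n.Partition}
    (h : ∀ i ∈ Finset.Icc 1 n, π.parts.count i = ρ.parts.count i) : π = ρ := by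
  refine Nat.Partition.ext (Multiset.ext.2 fun i => ?_)
  by_cases hi : i ∈ Finset.Icc 1 n
  · exact h i hi
  · have key : ∀ τ : n.Partition, τ.parts.count i = 0 := fun τ =>
      Multiset.count_eq_zero_of_notMem fun hm => hi <| Finset.mem_Icc.2
        ⟨τ.parts_pos hm, (Multiset.le_sum_of_mem hm).trans_eq τ.parts_sum⟩
    rw [key, key]

theorem count_le {n : ℕ} (π : n.Partition) {i : ℕ} : π.parts.count i ≤ n := by
  refine (Multiset.count_le_card _ _).trans ?_
  have := Multiset.card_nsmul_le_sum (s := π.parts) (a := 1) fun x hx => π.parts_pos hx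
  rw [π.parts_sum] at this
  simpa using this

theorem sum_mul_count {n N : ℕ} (h : n ≤ N) (π : n.Partition) :
    ∑ i ∈ Finset.Icc 1 N, i * π.parts.count i = n := by
  have h1 := Finset.sum_multiset_count_of_subset π.parts (Finset.Icc 1 N) (by
    intro i hi
    rw [Multiset.mem_toFinset] at hi
    exact Finset.mem_Icc.2
        ⟨π.parts_pos hi, ((Multiset.le_sum_of_mem hi).trans_eq π.parts_sum).trans h⟩)
  rw [π.parts_sum] at h1
  conv_rhs => rw [h1]
  exact Finset.sum_congr rfl fun i _ => by rw [smul_eq_mul, mul_comm]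

theorem sum_prod_le_prod_sum {n k : ℕ} (R S : Finset ℕ) (e : ℕ → Fin k → ℕ)
    (hcov : ∀ i ∈ Finset.Icc 1 n, i ∈ R ∨ ∃ j ∈ S, ∃ m, e j m = i)
    (w : ℕ → ℕ → ℝ) (hw : ∀ i c, 0 ≤ w i c) (G : ℕ → (Fin k → ℕ) → ℝ) (hG : ∀ j c, 0 ≤ G j c) :
    ∑ π : n.Partition, ((∏ i ∈ R, w i (π.parts.count i)) *
        ∏ j ∈ S, G j fun m => π.parts.count (e j m)) ≤
      (∏ i ∈ R, ∑ c ∈ Finset.range (n + 1), w i c) *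
        ∏ j ∈ S, ∑ c : Fin k → Fin (n + 1), G j fun m => c m := by
  let f : n.Partition → (R → Fin (n + 1)) × (S → Fin k → Fin (n + 1)) := fun π =>
    (fun i => ⟨π.parts.count i.1, Nat.lt_succ_of_le π.count_le⟩,
      fun j m => ⟨π.parts.count (e j.1 m), Nat.lt_succ_of_le π.count_le⟩)
  have hf : Function.Injective f := by
    intro π ρ h
    refine eq_of_forall_count_eq fun i hi => ?_
    rcases hcov i hi with hi | ⟨j, hj, m, rfl⟩
    · have := congrFun (congrArg Prod.fst h) ⟨i, hi⟩
      exact Fin.mk.inj_iff.1 this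
    · have := congrFun (congrFun (congrArg Prod.snd h) ⟨j, hj⟩) m
      exact Fin.mk.inj_iff.1 this
  let Φ : (R → Fin (n + 1)) × (S → Fin k → Fin (n + 1)) → ℝ := fun x =>
    (∏ i, w i.1 (x.1 i)) * ∏ j, G j.1 fun m => x.2 j m
  have h1 : ∀ π : n.Partition, (∏ i ∈ R, w i (π.parts.count i)) *
      ∏ j ∈ S, G j (fun m => π.parts.count (e j m)) = Φ (f π) := by
    intro π
    rw [← Finset.prod_coe_sort R, ← Finset.prod_coe_sort S]
  have h2 : ∀ x, 0 ≤ Φ x := fun x =>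
    mul_nonneg (Finset.prod_nonneg fun _ _ => hw _ _) (Finset.prod_nonneg fun _ _ => hG _ _)
  calc _ = ∑ π, Φ (f π) := Finset.sum_congr rfl fun π _ => h1 π
    _ = ∑ x ∈ Finset.univ.map ⟨f, hf⟩, Φ x := by rw [Finset.sum_map]; rfl
    _ ≤ ∑ x, Φ x := Finset.sum_le_univ_sum_of_nonneg h2
    _ = _ := by
      rw [Fintype.sum_prod_type]
      simp only [Φ]
      rw [← Finset.sum_mul_sum, ← Finset.prod_coe_sort R, ← Finset.prod_coe_sort S]
      congr 1
      · simp_rw [Finset.sum_range]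
        rw [Fintype.prod_sum]
      · rw [Fintype.prod_sum]

end Nat.Partition

theorem sum_range_pow_le_inv {x : ℝ} (h0 : 0 ≤ x) (h1 : x < 1) (n : ℕ) :
    ∑ c ∈ Finset.range n, x ^ c ≤ (1 - x)⁻¹ := by
  rw [← tsum_geometric_of_lt_one h0 h1]
  exact (summable_geometric_of_lt_one h0 h1).sum_le_tsum _ fun _ _ => by positivity

theorem sum_range_succ_mul_pow_le {x : ℝ} (h0 : 0 ≤ x) (h1 : x < 1) (n : ℕ) :
    ∑ c ∈ Finset.range n, ((c : ℝ) + 1) * x ^ c ≤ (1 - x)⁻¹ * (1 - x)⁻¹ := by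
  have hx : ‖x‖ < 1 := by rwa [Real.norm_of_nonneg h0]
  have h2 : HasSum (fun c : ℕ => ((c : ℝ) + 1) * x ^ c) ((1 - x)⁻¹ * (1 - x)⁻¹) := by
    have h3 := (hasSum_coe_mul_geometric_of_norm_lt_one hx).add
      (hasSum_geometric_of_lt_one h0 h1)
    have h4 : 1 - x ≠ 0 := by linarith
    have h5 : (fun c : ℕ => ((c : ℝ) + 1) * x ^ c) = fun c : ℕ => (c : ℝ) * x ^ c + x ^ c := by
      funext c; ring
    have h6 : (1 - x)⁻¹ * (1 - x)⁻¹ = x / (1 - x) ^ 2 + (1 - x)⁻¹ := by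
      field_simp; ring
    rw [h5, h6]
    exact h3
  rw [← h2.tsum_eq]
  exact h2.summable.sum_le_tsum _ fun _ _ => by positivity

namespace Nat.Partition

theorem pow_mul_sum_prod_le {q : ℝ} (h0 : 0 < q) (h1 : q < 1) {n N : ℕ} (hn : n ≤ N)
    (S : Finset ℕ) (hS : S ⊆ Finset.Icc 1 N) :
    q ^ n * ∑ π : n.Partition, ∏ M ∈ S, ((M : ℝ) * (π.parts.count M + 1)) ≤
      (∏ i ∈ Finset.Icc 1 N, (1 - q ^ i)⁻¹) * ∏ M ∈ S, ((M : ℝ) * (1 - q ^ M)⁻¹) := by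
  classical
  have hq : ∀ i ∈ Finset.Icc 1 N, q ^ i < 1 := fun i hi =>
    pow_lt_one₀ h0.le h1 (by have := (Finset.mem_Icc.1 hi).1; omega)
  have e1 : ∀ f : ℕ → ℝ, ∏ M ∈ S, f M = ∏ i ∈ Finset.Icc 1 N, if i ∈ S then f i else 1 := by
    intro f
    rw [Finset.prod_ite_mem, Finset.inter_eq_right.2 hS]
  have key := sum_prod_le_prod_sum (n := n) (k := 0) (Finset.Icc 1 N) ∅ (fun _ _ => 0)
    (fun i hi => Or.inl (Finset.Icc_subset_Icc_right hn hi))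
    (fun i c => (q ^ i) ^ c * if i ∈ S then (i : ℝ) * (c + 1) else 1)
    (fun i c => by split_ifs <;> positivity) (fun _ _ => 1) (fun _ _ => zero_le_one)
  simp only [Finset.prod_empty, mul_one] at key
  calc _ = ∑ π : n.Partition, ∏ i ∈ Finset.Icc 1 N, ((q ^ i) ^ π.parts.count i *
        if i ∈ S then (i : ℝ) * (π.parts.count i + 1) else 1) := by
        rw [Finset.mul_sum]
        refine Finset.sum_congr rfl fun π _ => ?_
        rw [e1, Finset.prod_mul_distrib (f := fun i => (q ^ i) ^ π.parts.count i)]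
        congr 1
        simp_rw [← pow_mul]
        rw [Finset.prod_pow_eq_pow_sum, π.sum_mul_count hn]
    _ ≤ _ := key
    _ ≤ ∏ i ∈ Finset.Icc 1 N, ((1 - q ^ i)⁻¹ * if i ∈ S then (i : ℝ) * (1 - q ^ i)⁻¹ else 1) := by
        refine Finset.prod_le_prod (fun i _ => Finset.sum_nonneg fun c _ => ?_) fun i hi => ?_
        · split_ifs <;> positivity
        · split_ifs with h
          · have h2 := sum_range_succ_mul_pow_le (by positivity) (hq i hi) (n + 1)
            calc _ = (i : ℝ) * ∑ c ∈ Finset.range (n + 1), ((c : ℝ) + 1) * (q ^ i) ^ c := by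
                  rw [Finset.mul_sum]
                  exact Finset.sum_congr rfl fun c _ => by ring
              _ ≤ (i : ℝ) * ((1 - q ^ i)⁻¹ * (1 - q ^ i)⁻¹) := by gcongr
              _ = _ := by ring
          · simp only [mul_one]
            exact sum_range_pow_le_inv (by positivity) (hq i hi) _
    _ = _ := by rw [Finset.prod_mul_distrib, ← e1]

end Nat.Partition

/-- The probability (up to normalisation) that the multiplicities along a chain
`j, j p, …, j p ^ k` of part sizes represent some integer in `[p ^ (k + 1), 2 p ^ (k + 1))`. -/
noncomputable def chainWeight (p k : ℕ) (y : ℝ) : ℝ :=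
  y ^ p ^ (k + 1) * (1 - y ^ p ^ (k + 1)) *
    ∏ m : Fin k, ((p ^ (k - m) / (k + 1) + 1 : ℕ) * (1 - y ^ p ^ ((m : ℕ) + 1)))

theorem chainWeight_le_sum {p : ℕ} (hp : 2 ≤ p) (k : ℕ) {y : ℝ} (h0 : 0 ≤ y) (h1 : y < 1)
    {n : ℕ} (hn : 2 * p ^ (k + 1) ≤ n) :
    chainWeight p k y * ∏ m : Fin (k + 1), (1 - y ^ p ^ (m : ℕ))⁻¹ ≤
      ∑ c ∈ Finset.univ.filter fun c : Fin (k + 1) → Fin (n + 1) =>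
        p ^ (k + 1) ≤ ∑ m, (c m : ℕ) * p ^ (m : ℕ), y ^ ∑ m, (c m : ℕ) * p ^ (m : ℕ) := by
  classical
  have hpos : 0 < p := by omega
  set T := p ^ (k + 1) with hT
  have hT1 : 1 ≤ T := Nat.one_le_pow _ _ hpos
  let A := Fin T × ((m : Fin k) → Fin (p ^ (k - m) / (k + 1) + 1))
  have ha : ∀ x : A, ∀ m : Fin k, (x.2 m : ℕ) * p ^ ((m : ℕ) + 1) ≤ T / (k + 1) := by
    intro x m
    have h2 : (x.2 m : ℕ) ≤ p ^ (k - m) / (k + 1) := Nat.lt_succ_iff.1 (x.2 m).2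
    rw [Nat.le_div_iff_mul_le (by omega)] at h2 ⊢
    calc (x.2 m : ℕ) * p ^ ((m : ℕ) + 1) * (k + 1) =
          (x.2 m : ℕ) * (k + 1) * p ^ ((m : ℕ) + 1) := by ring
      _ ≤ p ^ (k - m) * p ^ ((m : ℕ) + 1) := Nat.mul_le_mul_right _ h2
      _ = T := by rw [← pow_add, hT]; congr 1; omega
  have hsum : ∀ x : A, ∑ m : Fin k, (x.2 m : ℕ) * p ^ ((m : ℕ) + 1) ≤ T := by
    intro x
    refine (Finset.sum_le_sum fun m _ => ha x m).trans ?_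
    rw [Finset.sum_const, Finset.card_univ, Fintype.card_fin, smul_eq_mul]
    calc k * (T / (k + 1)) ≤ (k + 1) * (T / (k + 1)) := Nat.mul_le_mul_right _ (by omega)
      _ ≤ T := Nat.mul_div_le _ _
  have hle : ∀ x : A, ∀ m : Fin k, (x.2 m : ℕ) < n + 1 := by
    intro x m
    have h2 := ha x m
    have h3 : T / (k + 1) ≤ T := Nat.div_le_self _ _
    have h4 : 1 ≤ p ^ ((m : ℕ) + 1) := Nat.one_le_pow _ _ hpos
    have h5 : (x.2 m : ℕ) ≤ (x.2 m : ℕ) * p ^ ((m : ℕ) + 1) := Nat.le_mul_of_pos_right _ h4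
    omega
  let f : A → Fin (k + 1) → Fin (n + 1) := fun x =>
    Fin.cons ⟨T + x.1 - ∑ m : Fin k, (x.2 m : ℕ) * p ^ ((m : ℕ) + 1), by
      have := x.1.2; omega⟩ fun m => ⟨x.2 m, hle x m⟩
  have hfs : ∀ x, ∑ m, (f x m : ℕ) * p ^ (m : ℕ) = T + x.1 := by
    intro x
    rw [Fin.sum_univ_succ]
    simp only [f, Fin.cons_zero, Fin.cons_succ, Fin.val_zero, pow_zero, mul_one, Fin.val_succ]
    have := hsum x
    omega
  have hf : Function.Injective f := by
    intro x x' h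
    have e1 : x.1 = x'.1 := by
      have h2 := hfs x
      rw [h, hfs x'] at h2
      exact Fin.ext (by omega)
    have e2 : x.2 = x'.2 := by
      funext m
      have h2 := congrFun h m.succ
      simp only [f, Fin.cons_succ, Fin.mk.injEq] at h2
      exact Fin.ext h2
    exact Prod.ext e1 e2
  have h3 : ∑ x : A, y ^ (T + (x.1 : ℕ)) ≤
      ∑ c ∈ Finset.univ.filter fun c : Fin (k + 1) → Fin (n + 1) =>
        T ≤ ∑ m, (c m : ℕ) * p ^ (m : ℕ), y ^ ∑ m, (c m : ℕ) * p ^ (m : ℕ) := by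
    calc _ = ∑ x : A, y ^ ∑ m, (f x m : ℕ) * p ^ (m : ℕ) := by simp_rw [hfs]
      _ = ∑ c ∈ Finset.univ.map ⟨f, hf⟩, y ^ ∑ m, (c m : ℕ) * p ^ (m : ℕ) := by
          rw [Finset.sum_map]; rfl
      _ ≤ _ := by
          refine Finset.sum_le_sum_of_subset_of_nonneg ?_ fun _ _ _ => by positivity
          intro c hc
          obtain ⟨x, -, rfl⟩ := Finset.mem_map.1 hc
          rw [Finset.mem_filter]
          refine ⟨Finset.mem_univ _, ?_⟩
          change T ≤ ∑ m, (f x m : ℕ) * p ^ (m : ℕ)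
          rw [hfs]; omega
  refine le_trans (le_of_eq ?_) h3
  have h4 : ∑ x : A, y ^ (T + (x.1 : ℕ)) =
      (∑ u ∈ Finset.range T, y ^ (T + u)) * ∏ m : Fin k, ((p ^ (k - m) / (k + 1) + 1 : ℕ) : ℝ) := by
    rw [Fintype.sum_prod_type, Finset.sum_range, Finset.sum_mul]
    refine Finset.sum_congr rfl fun u _ => ?_
    simp only [Finset.sum_const, Finset.card_univ, Fintype.card_pi, Fintype.card_fin, nsmul_eq_mul]
    push_cast
    ring
  have hy1 : (1 - y) ≠ 0 := by linarith
  have h5 : ∑ u ∈ Finset.range T, y ^ (T + u) = y ^ T * (1 - y ^ T) * (1 - y)⁻¹ := by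
    simp_rw [pow_add]
    rw [← Finset.mul_sum, geom_sum_eq (by linarith), mul_assoc]
    congr 1
    have : y - 1 ≠ 0 := by linarith
    field_simp
    ring
  rw [h4, h5, chainWeight, Fin.prod_univ_succ, Finset.prod_mul_distrib]
  have h6 : (∏ m : Fin k, (1 - y ^ p ^ ((m : ℕ) + 1))) * ∏ m : Fin k, (1 - y ^ p ^ (m.succ : ℕ))⁻¹
      = 1 := by
    rw [← Finset.prod_mul_distrib]
    refine Finset.prod_eq_one fun m _ => ?_
    rw [Fin.val_succ]
    refine mul_inv_cancel₀ ?_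
    have : y ^ p ^ ((m : ℕ) + 1) < 1 := pow_lt_one₀ h0 h1 (pow_pos hpos _).ne'
    linarith
  simp only [Fin.val_zero, pow_zero, pow_one]
  linear_combination (y ^ T * (1 - y ^ T) * (1 - y)⁻¹ *
    ∏ m : Fin k, ((p ^ (k - m) / (k + 1) + 1 : ℕ) : ℝ)) * h6

theorem Finset.prod_Icc_eq_prod_sdiff_mul_prod_chain {N k p : ℕ} (S : Finset ℕ)
    (hmem : ∀ j ∈ S, ∀ m : Fin k, j * p ^ (m : ℕ) ∈ Finset.Icc 1 N)
    (hinj : ∀ j ∈ S, ∀ j' ∈ S, ∀ m m' : Fin k, j * p ^ (m : ℕ) = j' * p ^ (m' : ℕ) →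
      j = j' ∧ m = m') {R : Type*} [CommMonoid R] (f : ℕ → R) :
    ∏ i ∈ Finset.Icc 1 N, f i =
      (∏ i ∈ Finset.Icc 1 N \ ((S ×ˢ (Finset.univ : Finset (Fin k))).image
          fun x => x.1 * p ^ (x.2 : ℕ)), f i) * ∏ j ∈ S, ∏ m : Fin k, f (j * p ^ (m : ℕ)) := by
  rw [← Finset.prod_sdiff (s₁ := (S ×ˢ (Finset.univ : Finset (Fin k))).image
          fun x => x.1 * p ^ (x.2 : ℕ)) (s₂ := Finset.Icc 1 N)]
  · congr 1
    rw [Finset.prod_image, Finset.prod_product]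
    rintro ⟨j, m⟩ h ⟨j', m'⟩ h' heq
    obtain ⟨h1, h2⟩ := hinj j (Finset.mem_product.1 h).1 j' (Finset.mem_product.1 h').1 m m' heq
    rw [h1, h2]
  · intro i hi
    obtain ⟨⟨j, m⟩, h, rfl⟩ := Finset.mem_image.1 hi
    exact hmem j (Finset.mem_product.1 h).1 m

theorem chain_sum_le {p : ℕ} (hp : 2 ≤ p) (k : ℕ) {y : ℝ} (h0 : 0 ≤ y) (h1 : y < 1)
    {n : ℕ} (hn : 2 * p ^ (k + 1) ≤ n) :
    ∑ c : Fin (k + 1) → Fin (n + 1), y ^ (∑ m, (c m : ℕ) * p ^ (m : ℕ)) *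
        (if p ^ (k + 1) ≤ ∑ m, (c m : ℕ) * p ^ (m : ℕ) then 1 / 2 else 1) ≤
      (∏ m : Fin (k + 1), (1 - y ^ p ^ (m : ℕ))⁻¹) * (1 - chainWeight p k y / 2) := by
  have e1 : ∀ c : Fin (k + 1) → Fin (n + 1), y ^ (∑ m, (c m : ℕ) * p ^ (m : ℕ)) *
        (if p ^ (k + 1) ≤ ∑ m, (c m : ℕ) * p ^ (m : ℕ) then 1 / 2 else 1) =
      y ^ (∑ m, (c m : ℕ) * p ^ (m : ℕ)) - (if p ^ (k + 1) ≤ ∑ m, (c m : ℕ) * p ^ (m : ℕ) then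
        y ^ (∑ m, (c m : ℕ) * p ^ (m : ℕ)) else 0) / 2 := by
    intro c; split_ifs <;> ring
  simp_rw [e1]
  rw [Finset.sum_sub_distrib, ← Finset.sum_div, ← Finset.sum_filter]
  have h2 := chainWeight_le_sum hp k h0 h1 hn
  have h3 : ∑ c : Fin (k + 1) → Fin (n + 1), y ^ (∑ m, (c m : ℕ) * p ^ (m : ℕ)) ≤
      ∏ m : Fin (k + 1), (1 - y ^ p ^ (m : ℕ))⁻¹ := by
    calc _ = ∑ c : Fin (k + 1) → Fin (n + 1), ∏ m : Fin (k + 1), (y ^ p ^ (m : ℕ)) ^ (c m : ℕ) := by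
          refine Finset.sum_congr rfl fun c _ => ?_
          rw [← Finset.prod_pow_eq_pow_sum]
          exact Finset.prod_congr rfl fun m _ => by rw [← pow_mul, mul_comm]
      _ = ∏ m : Fin (k + 1), ∑ c : Fin (n + 1), (y ^ p ^ (m : ℕ)) ^ (c : ℕ) :=
          (Fintype.prod_sum fun (m : Fin (k + 1)) (c : Fin (n + 1)) =>
            (y ^ p ^ (m : ℕ)) ^ (c : ℕ)).symm
      _ ≤ _ := by
          refine Finset.prod_le_prod (fun m _ => Finset.sum_nonneg fun _ _ => by positivity)
            fun m _ => ?_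
          rw [← Finset.sum_range fun c => (y ^ p ^ (m : ℕ)) ^ c]
          exact sum_range_pow_le_inv (by positivity)
            (pow_lt_one₀ h0 h1 (pow_pos (by omega) _).ne') _
  linarith

namespace Nat.Partition

theorem pow_mul_card_filter_chain_le {q : ℝ} (h0 : 0 < q) (h1 : q < 1) {N k p : ℕ} (hp : 2 ≤ p)
    (hN : 2 * p ^ (k + 1) ≤ N) (S : Finset ℕ)
    (hmem : ∀ j ∈ S, ∀ m : Fin (k + 1), j * p ^ (m : ℕ) ∈ Finset.Icc 1 N)
    (hinj : ∀ j ∈ S, ∀ j' ∈ S, ∀ m m' : Fin (k + 1), j * p ^ (m : ℕ) = j' * p ^ (m' : ℕ) →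
      j = j' ∧ m = m') (J : ℕ) :
    q ^ N * ((Finset.univ.filter fun π : N.Partition => (S.filter fun j =>
        p ^ (k + 1) ≤ ∑ m : Fin (k + 1), π.parts.count (j * p ^ (m : ℕ)) * p ^ (m : ℕ)).card
          < J).card : ℝ) ≤
      2 ^ J * ((∏ i ∈ Finset.Icc 1 N, (1 - q ^ i)⁻¹) *
        ∏ j ∈ S, (1 - chainWeight p k (q ^ j) / 2)) := by
  classical
  have hpos : 0 < p := by omega
  set C := (S ×ˢ (Finset.univ : Finset (Fin (k + 1)))).image fun x => x.1 * p ^ (x.2 : ℕ) with hC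
  have hdec := fun f : ℕ → ℝ => Finset.prod_Icc_eq_prod_sdiff_mul_prod_chain S hmem hinj f
  set G : ℕ → (Fin (k + 1) → ℕ) → ℝ := fun j c => (q ^ j) ^ (∑ m, c m * p ^ (m : ℕ)) *
        (if p ^ (k + 1) ≤ ∑ m, c m * p ^ (m : ℕ) then 1 / 2 else 1) with hG
  have hG0 : ∀ j c, 0 ≤ G j c := fun j c => by simp only [hG]; split_ifs <;> positivity
  have hq : ∀ i, 1 ≤ i → q ^ i < 1 := fun i hi => pow_lt_one₀ h0.le h1 (by omega)
  have key := sum_prod_le_prod_sum (n := N) (k := k + 1) (Finset.Icc 1 N \ C) S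
    (fun j m => j * p ^ (m : ℕ)) (by
      intro i hi
      by_cases hiC : i ∈ C
      · right
        obtain ⟨⟨j, m⟩, h, rfl⟩ := Finset.mem_image.1 hiC
        exact ⟨j, (Finset.mem_product.1 h).1, m, rfl⟩
      · exact Or.inl (Finset.mem_sdiff.2 ⟨hi, hiC⟩))
    (fun i c => (q ^ i) ^ c) (fun i c => by positivity) G hG0
  have hterm : ∀ π : N.Partition, (∏ i ∈ Finset.Icc 1 N \ C, (q ^ i) ^ π.parts.count i) *
      ∏ j ∈ S, G j (fun m => π.parts.count (j * p ^ (m : ℕ))) =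
      q ^ N * (1 / 2) ^ (S.filter fun j =>
        p ^ (k + 1) ≤ ∑ m : Fin (k + 1), π.parts.count (j * p ^ (m : ℕ)) * p ^ (m : ℕ)).card := by
    intro π
    have e1 : q ^ N = ∏ i ∈ Finset.Icc 1 N, (q ^ i) ^ π.parts.count i := by
      simp_rw [← pow_mul]
      rw [Finset.prod_pow_eq_pow_sum, π.sum_mul_count le_rfl]
    rw [e1, hdec]
    simp only [hG]
    rw [Finset.prod_mul_distrib, ← Finset.prod_filter, Finset.prod_const, ← mul_assoc]
    congr 2
    refine Finset.prod_congr rfl fun j _ => ?_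
    rw [← Finset.prod_pow_eq_pow_sum]
    exact Finset.prod_congr rfl fun m _ => by
      rw [← pow_mul, ← pow_mul]; congr 1; ring
  simp_rw [hterm] at key
  have hlow : q ^ N * ((Finset.univ.filter fun π : N.Partition => (S.filter fun j =>
        p ^ (k + 1) ≤ ∑ m : Fin (k + 1), π.parts.count (j * p ^ (m : ℕ)) * p ^ (m : ℕ)).card
          < J).card : ℝ) ≤ 2 ^ J * ∑ π : N.Partition, q ^ N * (1 / 2) ^ (S.filter fun j =>
        p ^ (k + 1) ≤ ∑ m : Fin (k + 1), π.parts.count (j * p ^ (m : ℕ)) * p ^ (m : ℕ)).card := by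
    rw [Finset.card_filter, Nat.cast_sum, Finset.mul_sum, Finset.mul_sum]
    refine Finset.sum_le_sum fun π _ => ?_
    split_ifs with h
    · rw [Nat.cast_one, mul_one, mul_left_comm]
      refine le_mul_of_one_le_right (by positivity) ?_
      rw [one_div, inv_pow, ← div_eq_mul_inv, one_le_div (by positivity)]
      exact pow_le_pow_right₀ (by norm_num) h.le
    · rw [Nat.cast_zero, mul_zero]; positivity
  refine hlow.trans (mul_le_mul_of_nonneg_left (key.trans ?_) (by positivity))
  calc _ ≤ (∏ i ∈ Finset.Icc 1 N \ C, (1 - q ^ i)⁻¹) * ∏ j ∈ S,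
        ((∏ m : Fin (k + 1), (1 - q ^ (j * p ^ (m : ℕ)))⁻¹) *
          (1 - chainWeight p k (q ^ j) / 2)) := by
        refine mul_le_mul ?_ ?_ ?_ ?_
        · refine Finset.prod_le_prod (fun i _ => Finset.sum_nonneg fun _ _ => by positivity) ?_
          intro i hi
          exact sum_range_pow_le_inv (by positivity)
            (hq i (Finset.mem_Icc.1 (Finset.mem_sdiff.1 hi).1).1) _
        · refine Finset.prod_le_prod (fun i _ => Finset.sum_nonneg fun _ _ => hG0 _ _) ?_
          intro j hj
          have hj1 : 1 ≤ j := by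
            have := (Finset.mem_Icc.1 (hmem j hj 0)).1
            simpa using this
          refine (chain_sum_le hp k (by positivity) (hq j hj1) hN).trans (le_of_eq ?_)
          simp_rw [pow_mul]
        · exact Finset.prod_nonneg fun i _ => Finset.sum_nonneg fun _ _ => hG0 _ _
        · refine Finset.prod_nonneg fun i hi => ?_
          have := hq i (Finset.mem_Icc.1 (Finset.mem_sdiff.1 hi).1).1
          exact inv_nonneg.2 (by linarith)
    _ = _ := by rw [hdec, Finset.prod_mul_distrib, mul_assoc]

end Nat.Partition

theorem sum_Icc_exp_neg_mul_le {x : ℝ} (hx : 0 < x) (n : ℕ) :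
    ∑ l ∈ Finset.Icc 1 n, Real.exp (-(x * l)) ≤ 1 / x := by
  have h1 : Real.exp (-x) < 1 := by simpa using by assumption
  have e1 : ∑ l ∈ Finset.Icc 1 n, Real.exp (-(x * l)) =
      Real.exp (-x) * ∑ l ∈ Finset.range n, Real.exp (-x) ^ l := by
    rw [Finset.mul_sum, ← Finset.Ico_add_one_right_eq_Icc, Finset.sum_Ico_eq_sum_range]
    refine Finset.sum_congr (by simp) fun l _ => ?_
    rw [← pow_succ', ← Real.exp_nat_mul]
    congr 1; push_cast; ring
  rw [e1]
  refine (mul_le_mul_of_nonneg_left (sum_range_pow_le_inv (Real.exp_pos _).le h1 n)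
    (Real.exp_pos _).le).trans ?_
  rw [← div_eq_mul_inv, div_le_div_iff₀ (by linarith) hx, Real.exp_neg]
  have h2 := Real.add_one_le_exp x
  have h3 := Real.exp_pos x
  field_simp
  linarith

theorem hasSum_one_div_succ_sq : HasSum (fun m : ℕ => 1 / ((m : ℝ) + 1) ^ 2) (Real.pi ^ 2 / 6) := by
  have := (hasSum_nat_add_iff' 1).2 hasSum_zeta_two
  simpa using this

theorem prod_inv_one_sub_exp_le {c : ℝ} (hc : 0 < c) (N : ℕ) :
    ∏ i ∈ Finset.Icc 1 N, (1 - Real.exp (-c) ^ i)⁻¹ ≤ Real.exp (Real.pi ^ 2 / 6 / c) := by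
  have h1 : Real.exp (-c) < 1 := by simpa using by assumption
  have hlt : ∀ i ∈ Finset.Icc 1 N, Real.exp (-c) ^ i < 1 := fun i hi =>
    pow_lt_one₀ (Real.exp_pos _).le h1 (by have := (Finset.mem_Icc.1 hi).1; omega)
  have h2 : HasSum (fun m : ℕ =>
      ∑ i ∈ Finset.Icc 1 N, (Real.exp (-c) ^ i) ^ (m + 1) / ((m : ℝ) + 1))
      (∑ i ∈ Finset.Icc 1 N, -Real.log (1 - Real.exp (-c) ^ i)) :=
    hasSum_sum fun i hi => Real.hasSum_pow_div_log_of_abs_lt_one (by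
      rw [abs_of_nonneg (by positivity)]; exact hlt i hi)
  have h3 := hasSum_one_div_succ_sq.mul_left (1 / c)
  have h4 := hasSum_le (fun m : ℕ => ?_) h2 h3
  · rw [Finset.prod_congr rfl fun i hi => show (1 - Real.exp (-c) ^ i)⁻¹ =
      Real.exp (-Real.log (1 - Real.exp (-c) ^ i)) by
        rw [Real.exp_neg (Real.log _), Real.exp_log (by have := hlt i hi; linarith)],
      ← Real.exp_sum,
      Real.exp_le_exp]
    refine h4.trans (le_of_eq ?_)
    ring
  · rw [← Finset.sum_div]
    have h5 := sum_Icc_exp_neg_mul_le (x := c * (m + 1)) (by positivity) N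
    rw [div_le_iff₀ (by positivity)]
    calc _ = ∑ l ∈ Finset.Icc 1 N, Real.exp (-(c * (m + 1) * l)) := by
          refine Finset.sum_congr rfl fun l _ => ?_
          rw [← pow_mul, ← Real.exp_nat_mul]
          congr 1; push_cast; ring
      _ ≤ _ := h5
      _ = _ := by field_simp

theorem sub_le_sum_mul_exp {x t : ℝ} (hx : 0 < x) (s : Finset ℕ)
    (hs : ∀ l : ℕ, l ≠ 0 → l ∉ s → t ≤ x * l / 2) :
    1 / x ^ 2 - 1 - Real.exp (-t) * (4 / x ^ 2) ≤ ∑ l ∈ s, (l : ℝ) * Real.exp (-(x * l)) := by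
  have key : ∀ y : ℝ, 0 < y → HasSum (fun l : ℕ => (l : ℝ) * Real.exp (-(y * l)))
      (1 / (2 * Real.sinh (y / 2)) ^ 2) := by
    intro y hy
    have h1 : Real.exp (-y) < 1 := by simpa using by assumption
    have h2 := hasSum_coe_mul_geometric_of_norm_lt_one (r := Real.exp (-y))
      (by rwa [Real.norm_of_nonneg (Real.exp_pos _).le])
    have e0 : (fun l : ℕ => (l : ℝ) * Real.exp (-(y * l))) =
        fun l : ℕ => (l : ℝ) * Real.exp (-y) ^ l := by
      funext l
      rw [← Real.exp_nat_mul]; congr 2; ring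
    have e3 : 1 / (2 * Real.sinh (y / 2)) ^ 2 = Real.exp (-y) / (1 - Real.exp (-y)) ^ 2 := by
      rw [Real.sinh_eq]
      have e1 : Real.exp (-y) = (Real.exp (-(y / 2))) ^ 2 := by
        rw [← Real.exp_nat_mul]; congr 1; push_cast; ring
      have e2 : Real.exp (y / 2) = (Real.exp (-(y / 2)))⁻¹ := by rw [Real.exp_neg, inv_inv]
      have h3 : 0 < Real.exp (-(y / 2)) := Real.exp_pos _
      rw [e1] at h1 ⊢
      rw [e2]
      have h4 : 1 - Real.exp (-(y / 2)) ^ 2 ≠ 0 := by linarith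
      field_simp
    rw [e0, e3]
    exact h2
  have hlow : 1 / x ^ 2 - 1 ≤ 1 / (2 * Real.sinh (x / 2)) ^ 2 := by
    have h1 : x / 2 ≤ Real.sinh (x / 2) := Real.self_le_sinh_iff.2 (by linarith)
    have h2 := Real.cosh_le_exp_half_sq (x / 2)
    have h3 := Real.cosh_sq (x / 2)
    have h4 : Real.cosh (x / 2) ^ 2 ≤ Real.exp (x ^ 2 / 4) := by
      calc _ ≤ (Real.exp ((x / 2) ^ 2 / 2)) ^ 2 := by
            gcongr
        _ = _ := by rw [← Real.exp_nat_mul]; congr 1; push_cast; ring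
    by_cases hx1 : 1 ≤ x
    · have : 1 / x ^ 2 ≤ 1 := by rw [div_le_one (by positivity)]; nlinarith
      have : 0 ≤ 1 / (2 * Real.sinh (x / 2)) ^ 2 := by positivity
      linarith
    · push Not at hx1
      have h0 : 0 < Real.sinh (x / 2) := by linarith
      have hpos : 0 < (2 * Real.sinh (x / 2)) ^ 2 := by positivity
      have h5 : Real.exp (x ^ 2 / 4) * (1 - x ^ 2 / 4) ≤ 1 := by
        have := Real.one_sub_le_exp_neg (x ^ 2 / 4)
        calc _ ≤ Real.exp (x ^ 2 / 4) * Real.exp (-(x ^ 2 / 4)) := by gcongr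
          _ = 1 := by rw [← Real.exp_add]; simp
      rw [div_sub_one (by positivity), div_le_div_iff₀ (by positivity) hpos]
      nlinarith [sq_nonneg x, mul_pos hx hx, mul_pos (mul_pos hx hx) (mul_pos hx hx)]
  have hup : 1 / (2 * Real.sinh (x / 2 / 2)) ^ 2 ≤ 4 / x ^ 2 := by
    have h1 : x / 2 / 2 ≤ Real.sinh (x / 2 / 2) := Real.self_le_sinh_iff.2 (by linarith)
    have h0 : 0 < Real.sinh (x / 2 / 2) := by linarith
    have hpos : 0 < (2 * Real.sinh (x / 2 / 2)) ^ 2 := by positivity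
    rw [div_le_div_iff₀ hpos (by positivity)]
    nlinarith
  have h1 : HasSum (fun l : ℕ => if l ∈ s then (l : ℝ) * Real.exp (-(x * l)) else 0)
      (∑ l ∈ s, if l ∈ s then (l : ℝ) * Real.exp (-(x * l)) else 0) :=
    hasSum_sum_of_ne_finset_zero fun l hl => if_neg hl
  rw [Finset.sum_congr rfl fun l hl => if_pos hl] at h1
  have h2 := (key (x / 2) (by positivity)).mul_left (Real.exp (-t))
  have h3 := hasSum_le (fun l : ℕ => ?_) (key x hx) (h1.add h2)
  · have := mul_le_mul_of_nonneg_left hup (Real.exp_pos (-t)).le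
    linarith
  · split_ifs with h
    · have : 0 ≤ Real.exp (-t) * (l * Real.exp (-(x / 2 * l))) := by positivity
      linarith
    · rcases eq_or_ne l 0 with rfl | h0
      · simp
      rw [zero_add, mul_left_comm, ← Real.exp_add]
      gcongr
      have := hs l h0 h
      linarith

theorem sum_pow_three_mul_exp_le {x : ℝ} (hx : 0 < x) (n : ℕ) :
    ∑ l ∈ Finset.Icc 1 n, (l : ℝ) ^ 3 * Real.exp (-(x * l)) ≤ 96 / x ^ 4 := by
  have h1 := sum_Icc_exp_neg_mul_le (x := x / 2) (by positivity) n
  calc _ ≤ ∑ l ∈ Finset.Icc 1 n, 48 / x ^ 3 * Real.exp (-(x / 2 * l)) := by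
        refine Finset.sum_le_sum fun l _ => ?_
        have h2 := Real.pow_div_factorial_le_exp (x / 2 * l) (by positivity) 3
        have e1 : Real.exp (-(x * l)) = Real.exp (-(x / 2 * l)) * Real.exp (-(x / 2 * l)) := by
          rw [← Real.exp_add]; congr 1; ring
        rw [e1, ← mul_assoc]
        gcongr
        rw [Real.exp_neg, ← div_eq_mul_inv, div_le_div_iff₀ (Real.exp_pos _) (by positivity)]
        have e2 : (Nat.factorial 3 : ℝ) = 6 := by norm_num [Nat.factorial]
        rw [e2, div_le_iff₀ (by norm_num)] at h2
        nlinarith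
    _ = 48 / x ^ 3 * ∑ l ∈ Finset.Icc 1 n, Real.exp (-(x / 2 * l)) := by rw [Finset.mul_sum]
    _ ≤ 48 / x ^ 3 * (1 / (x / 2)) := by gcongr
    _ = _ := by field_simp; norm_num

namespace Nat.Partition

theorem card_le_card_filter_le_count {n k l : ℕ} (hl : 0 < l) (h : k * l ≤ n) :
    Fintype.card (n - k * l).Partition ≤
      (Finset.univ.filter fun π : n.Partition => k ≤ π.parts.count l).card := by
  let f : (n - k * l).Partition → n.Partition := fun ν =>
    { parts := ν.parts + Multiset.replicate k l
      parts_pos := by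
        intro i hi
        rcases Multiset.mem_add.1 hi with hi | hi
        · exact ν.parts_pos hi
        · rwa [Multiset.eq_of_mem_replicate hi]
      parts_sum := by
        rw [Multiset.sum_add, ν.parts_sum, Multiset.sum_replicate, smul_eq_mul]
        omega }
  rw [← Finset.card_univ]
  refine Finset.card_le_card_of_injOn f (fun ν _ => ?_) fun ν _ ν' _ h => ?_
  · simp only [Finset.coe_filter, Finset.mem_univ, true_and, Set.mem_ofPred_eq]
    change k ≤ (ν.parts + Multiset.replicate k l).count l
    rw [Multiset.count_add, Multiset.count_replicate_self]
    omega
  · exact Nat.Partition.ext (add_right_cancel (congrArg Nat.Partition.parts h))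

theorem sum_mul_card_le (n : ℕ) :
    ∑ k ∈ Finset.Icc 1 n, ∑ l ∈ (Finset.Icc 1 n).filter (fun l => k * l < n),
        l * Fintype.card (n - k * l).Partition ≤ n * Fintype.card n.Partition := by
  calc _ ≤ ∑ k ∈ Finset.Icc 1 n, ∑ l ∈ Finset.Icc 1 n,
          l * (Finset.univ.filter fun π : n.Partition => k ≤ π.parts.count l).card := by
        refine Finset.sum_le_sum fun k _ => ?_
        refine (Finset.sum_le_sum fun l hl => ?_).trans
          (Finset.sum_le_sum_of_subset (Finset.filter_subset _ _))
        rw [Finset.mem_filter, Finset.mem_Icc] at hl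
        exact Nat.mul_le_mul_left _ (card_le_card_filter_le_count (by omega) hl.2.le)
    _ = ∑ π : n.Partition, ∑ l ∈ Finset.Icc 1 n, l * π.parts.count l := by
        rw [Finset.sum_comm, Finset.sum_comm (s := Finset.univ)]
        refine Finset.sum_congr rfl fun l _ => ?_
        rw [← Finset.mul_sum, ← Finset.mul_sum]
        congr 1
        simp_rw [Finset.card_filter]
        rw [Finset.sum_comm]
        refine Finset.sum_congr rfl fun π _ => ?_
        rw [← Finset.card_filter]
        have : (Finset.Icc 1 n).filter (fun k => k ≤ π.parts.count l) =
            Finset.Icc 1 (π.parts.count l) := by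
          ext k
          have := π.count_le (i := l)
          simp only [Finset.mem_filter, Finset.mem_Icc]
          omega
        rw [this, Nat.card_Icc, Nat.add_sub_cancel]
    _ = _ := by
        simp_rw [sum_mul_count le_rfl]
        rw [Finset.sum_const, Finset.card_univ, smul_eq_mul, mul_comm]

end Nat.Partition

theorem pi_sq_div_six_sub_le_sum {K : ℕ} (hK : 0 < K) :
    Real.pi ^ 2 / 6 - 1 / K ≤ ∑ k ∈ Finset.Icc 1 K, 1 / (k : ℝ) ^ 2 := by
  have h1 := hasSum_zeta_two.tendsto_sum_nat
  have h2 : Real.pi ^ 2 / 6 ≤ ∑ k ∈ Finset.Icc 1 K, 1 / (k : ℝ) ^ 2 + 1 / K := by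
    refine le_of_tendsto h1 (Filter.eventually_atTop.2 ⟨K + 1, fun m hm => ?_⟩)
    have h3 := sum_Ioc_inv_sq_le_sub (α := ℝ) hK.ne' (show K ≤ m from by omega)
    have h4 : Finset.range m ⊆ insert 0 (Finset.Icc 1 K ∪ Finset.Ioc K m) := by
      intro i hi
      simp only [Finset.mem_insert, Finset.mem_union, Finset.mem_Icc, Finset.mem_Ioc,
        Finset.mem_range] at hi ⊢
      omega
    have h5 : (0 : ℕ) ∉ Finset.Icc 1 K ∪ Finset.Ioc K m := by simp
    refine (Finset.sum_le_sum_of_subset_of_nonneg h4 fun _ _ _ => by positivity).trans ?_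
    rw [Finset.sum_insert h5, Finset.sum_union]
    · have h6 : (0 : ℝ) ≤ (m : ℝ)⁻¹ := by positivity
      simp only [one_div] at h3 ⊢
      simp only [CharP.cast_eq_zero, ne_eq, OfNat.ofNat_ne_zero, not_false_eq_true, zero_pow,
        inv_zero, zero_add]
      linarith
    · rw [Finset.disjoint_left]
      intro i hi hi'
      rw [Finset.mem_Icc] at hi
      rw [Finset.mem_Ioc] at hi'
      omega
  linarith

theorem sum_Icc_one_div_sq_le (K : ℕ) :
    ∑ k ∈ Finset.Icc 1 K, 1 / (k : ℝ) ^ 2 ≤ Real.pi ^ 2 / 6 :=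
  sum_le_hasSum _ (fun _ _ => by positivity) hasSum_zeta_two

theorem one_lt_pi_sq_div_six : 1 < Real.pi ^ 2 / 6 := by
  nlinarith [Real.pi_gt_three]

theorem pi_sq_div_six_lt_four : Real.pi ^ 2 / 6 < 4 := by
  nlinarith [Real.pi_lt_four, Real.pi_pos]

section

variable {n : ℕ} {c : ℝ}

theorem sub_le_sum_sum_mul_exp (hn : 16 ≤ n) (hc : 0 < c) (hcn : c ^ 2 * n = Real.pi ^ 2 / 6) :
    (n : ℝ) - 11 * √n ≤ ∑ k ∈ Finset.Icc 1 n, ∑ l ∈ (Finset.Icc 1 n).filter (fun l => k * l < n),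
      (l : ℝ) * Real.exp (-(c * k * l)) := by
  set s := √(n : ℝ) with hs
  have hn' : (16 : ℝ) ≤ n := by exact_mod_cast hn
  have hss : s ^ 2 = n := Real.sq_sqrt (by positivity)
  have hs4 : 4 ≤ s := Real.le_sqrt_of_sq_le (by linarith)
  have hz1 := one_lt_pi_sq_div_six
  have hcs : 1 < c * s := by
    have : 1 < (c * s) ^ 2 := by rw [mul_pow, hss, hcn]; exact hz1
    exact (one_lt_sq_iff₀ (by positivity)).1 this
  set K := Nat.sqrt n with hK
  have hK1 : (K : ℝ) ≤ s := Real.le_sqrt_of_sq_le (by exact_mod_cast Nat.sqrt_le' n)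
  have hK2 : s < K + 1 := by
    rw [hs, Real.sqrt_lt' (by positivity)]
    exact_mod_cast Nat.lt_succ_sqrt' n
  have hKn : K ≤ n := Nat.sqrt_le_self n
  have hK0 : 0 < K := Nat.sqrt_pos.2 (by omega)
  have hKr : (0 : ℝ) < K := by exact_mod_cast hK0
  set E := Real.exp (-(c * n / 2)) with hE
  have hE0 : 0 < E := Real.exp_pos _
  have hE1 : E * s ≤ 2 := by
    have h1 := Real.add_one_le_exp (c * n / 2)
    have h2 : E * Real.exp (c * n / 2) = 1 := by rw [hE, ← Real.exp_add]; simp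
    have h3 : s / 2 ≤ Real.exp (c * n / 2) := by
      rw [← hss] at h1 ⊢
      nlinarith
    nlinarith
  calc (n : ℝ) - 11 * s ≤ ∑ k ∈ Finset.Icc 1 K, (1 / (c * k) ^ 2 - 1 - E * (4 / (c * k) ^ 2)) := by
        have e1 : ∑ k ∈ Finset.Icc 1 K, (1 / (c * k) ^ 2 - 1 - E * (4 / (c * k) ^ 2)) =
            1 / c ^ 2 * ∑ k ∈ Finset.Icc 1 K, 1 / (k : ℝ) ^ 2 - K -
              4 * E * (1 / c ^ 2) * ∑ k ∈ Finset.Icc 1 K, 1 / (k : ℝ) ^ 2 := by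
          rw [Finset.sum_sub_distrib, Finset.sum_sub_distrib, Finset.sum_const, Nat.card_Icc,
            Nat.add_sub_cancel, nsmul_eq_mul, mul_one, Finset.mul_sum, Finset.mul_sum]
          congr 1
          · congr 1
            refine Finset.sum_congr rfl fun k _ => ?_
            rw [mul_pow, one_div_mul_one_div]
          · refine Finset.sum_congr rfl fun k _ => ?_
            rw [mul_pow, div_eq_mul_one_div 4, ← one_div_mul_one_div]
            ring
        rw [e1]
        have h1 := pi_sq_div_six_sub_le_sum hK0
        have h2 := sum_Icc_one_div_sq_le K
        set Z := Real.pi ^ 2 / 6 with hZ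
        set T := ∑ k ∈ Finset.Icc 1 K, 1 / (k : ℝ) ^ 2
        have hcz : 1 / c ^ 2 = n / Z := by
          rw [← hcn]; field_simp
        have hZ0 : 0 < Z := by linarith
        have h3 : (n : ℝ) - n / K ≤ 1 / c ^ 2 * T := by
          rw [hcz]
          calc (n : ℝ) - n / K ≤ n / Z * (Z - 1 / K) := by
                have : (n : ℝ) / Z * (Z - 1 / K) = n - n / K * (1 / Z) := by field_simp
                rw [this]
                have h5 : 1 / Z ≤ 1 := by rw [div_le_one hZ0]; linarith
                have h6 : (0 : ℝ) ≤ n / K := by positivity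
                nlinarith
            _ ≤ _ := by gcongr
        have h4 : 4 * E * (1 / c ^ 2) * T ≤ 4 * E * n := by
          rw [hcz]
          calc _ ≤ 4 * E * (n / Z) * Z := by gcongr
            _ = _ := by field_simp
        have h5 : (n : ℝ) / K ≤ 2 * s := by
          rw [div_le_iff₀ hKr, ← hss]
          nlinarith
        have h6 : 4 * E * n ≤ 8 * s := by
          rw [← hss]; nlinarith
        linarith
    _ ≤ ∑ k ∈ Finset.Icc 1 K, ∑ l ∈ (Finset.Icc 1 n).filter (fun l => k * l < n),
          (l : ℝ) * Real.exp (-(c * k * l)) := by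
        refine Finset.sum_le_sum fun k hk => ?_
        have hk1 : 0 < k := (Finset.mem_Icc.1 hk).1
        refine sub_le_sum_mul_exp (by positivity) _ fun l hl0 hl => ?_
        have h1 : n ≤ k * l := by
          by_contra h
          refine hl (Finset.mem_filter.2 ⟨Finset.mem_Icc.2 ⟨by omega, ?_⟩, by omega⟩)
          have : l ≤ k * l := Nat.le_mul_of_pos_left _ hk1
          omega
        have h2 : (n : ℝ) ≤ k * l := by exact_mod_cast h1
        nlinarith
    _ ≤ _ := Finset.sum_le_sum_of_subset_of_nonneg (Finset.Icc_subset_Icc_right hKn)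
        fun _ _ _ => Finset.sum_nonneg fun _ _ => by positivity

theorem le_sum_sum_mul_sq_mul_exp (hn : 64 ≤ n) (hc : 0 < c)
    (hcn : c ^ 2 * n = Real.pi ^ 2 / 6) :
    Real.exp (-8) * √n * n ≤
      ∑ k ∈ Finset.Icc 1 n, ∑ l ∈ (Finset.Icc 1 n).filter (fun l => k * l < n),
        (l : ℝ) * (k * l) * Real.exp (-(c * k * l)) := by
  set s := √(n : ℝ) with hs
  have hn' : (64 : ℝ) ≤ n := by exact_mod_cast hn
  have hss : s ^ 2 = n := Real.sq_sqrt (by positivity)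
  have hs4 : 8 ≤ s := Real.le_sqrt_of_sq_le (by linarith)
  have hcs : c * s < 2 := by
    have : (c * s) ^ 2 < 2 ^ 2 := by
      rw [mul_pow, hss, hcn]; linarith [pi_sq_div_six_lt_four]
    exact lt_of_pow_lt_pow_left₀ 2 (by norm_num) this
  set K := Nat.sqrt n with hK
  have hK1 : (K : ℝ) ≤ s := Real.le_sqrt_of_sq_le (by exact_mod_cast Nat.sqrt_le' n)
  have hK2 : s < K + 1 := by
    rw [hs, Real.sqrt_lt' (by positivity)]
    exact_mod_cast Nat.lt_succ_sqrt' n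
  have hK8 : 8 ≤ K := Nat.le_sqrt'.2 (by omega)
  have hKK : K ^ 2 ≤ n := Nat.sqrt_le' n
  have hsub : Finset.Icc (K + 1) (2 * K + 1) ⊆ (Finset.Icc 1 n).filter (fun l => 1 * l < n) := by
    intro l hl
    rw [Finset.mem_Icc] at hl
    rw [Finset.mem_filter, Finset.mem_Icc]
    have : 2 * K + 1 < n := by nlinarith
    omega
  calc Real.exp (-8) * s * n ≤
        ∑ l ∈ Finset.Icc (K + 1) (2 * K + 1), Real.exp (-8) * n := by
        rw [Finset.sum_const, Nat.card_Icc, nsmul_eq_mul,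
          show 2 * K + 1 + 1 - (K + 1) = K + 1 by omega]
        have : 0 ≤ Real.exp (-8) * n := by positivity
        push_cast
        nlinarith
    _ ≤ ∑ l ∈ Finset.Icc (K + 1) (2 * K + 1),
        (l : ℝ) * ((1 : ℕ) * l) * Real.exp (-(c * (1 : ℕ) * l)) := by
        refine Finset.sum_le_sum fun l hl => ?_
        rw [Finset.mem_Icc] at hl
        have h1 : s ≤ l := hK2.le.trans (by exact_mod_cast hl.1)
        have h2 : (l : ℝ) ≤ 4 * s := by
          have : (l : ℝ) ≤ 2 * K + 1 := by exact_mod_cast hl.2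
          linarith
        rw [mul_comm]
        gcongr
        · rw [← hss, Nat.cast_one]; nlinarith
        · rw [Nat.cast_one]; nlinarith
    _ ≤ ∑ l ∈ (Finset.Icc 1 n).filter (fun l => 1 * l < n),
        (l : ℝ) * ((1 : ℕ) * l) * Real.exp (-(c * (1 : ℕ) * l)) :=
        Finset.sum_le_sum_of_subset_of_nonneg hsub fun _ _ _ => by positivity
    _ ≤ _ := Finset.single_le_sum (f := fun k : ℕ =>
          ∑ l ∈ (Finset.Icc 1 n).filter (fun l => k * l < n),
            (l : ℝ) * (k * l) * Real.exp (-(c * k * l)))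
        (fun k _ => Finset.sum_nonneg fun l _ => by positivity)
        (Finset.mem_Icc.2 ⟨le_rfl, by omega⟩)

theorem sum_sum_mul_cube_mul_exp_le (hc : 0 < c) (hcn : c ^ 2 * n = Real.pi ^ 2 / 6) :
    ∑ k ∈ Finset.Icc 1 n, ∑ l ∈ (Finset.Icc 1 n).filter (fun l => k * l < n),
        (l : ℝ) * (k * l) ^ 2 * Real.exp (-(c * k * l)) ≤ 96 * (n : ℝ) ^ 2 := by
  have hz1 := one_lt_pi_sq_div_six
  calc _ ≤ ∑ k ∈ Finset.Icc 1 n, 96 / c ^ 4 * (1 / (k : ℝ) ^ 2) := by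
        refine Finset.sum_le_sum fun k hk => ?_
        have hk1 : 0 < k := (Finset.mem_Icc.1 hk).1
        have hkr : (0 : ℝ) < k := by exact_mod_cast hk1
        calc _ ≤ ∑ l ∈ Finset.Icc 1 n, (l : ℝ) * (k * l) ^ 2 * Real.exp (-(c * k * l)) :=
              Finset.sum_le_sum_of_subset_of_nonneg (Finset.filter_subset _ _)
                fun _ _ _ => by positivity
          _ = (k : ℝ) ^ 2 * ∑ l ∈ Finset.Icc 1 n, (l : ℝ) ^ 3 * Real.exp (-(c * k * l)) := by
              rw [Finset.mul_sum]
              exact Finset.sum_congr rfl fun l _ => by ring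
          _ ≤ (k : ℝ) ^ 2 * (96 / (c * k) ^ 4) := by
              gcongr
              exact sum_pow_three_mul_exp_le (by positivity) n
          _ = _ := by field_simp
    _ = 96 / c ^ 4 * ∑ k ∈ Finset.Icc 1 n, 1 / (k : ℝ) ^ 2 := by rw [Finset.mul_sum]
    _ ≤ 96 / c ^ 4 * (Real.pi ^ 2 / 6) := by
        gcongr
        exact sum_Icc_one_div_sq_le n
    _ = 96 * (n : ℝ) ^ 2 / (Real.pi ^ 2 / 6) := by
        rw [← hcn]
        rcases eq_or_ne (n : ℝ) 0 with h | h
        · rw [h]; simp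
        · field_simp
    _ ≤ _ := div_le_self (by positivity) hz1.le

end

theorem sub_le_sqrt_one_sub {x : ℝ} (h0 : 0 ≤ x) (h1 : x ≤ 1) :
    1 - x / 2 - x ^ 2 / 2 ≤ √(1 - x) := by
  refine Real.le_sqrt_of_sq_le ?_
  nlinarith [mul_nonneg (sq_nonneg x) (sub_nonneg.2 h1),
    mul_nonneg (mul_nonneg (sq_nonneg x) (sub_nonneg.2 h1)) h0]

theorem sqrt_sub_log_sub_ge {w A x m : ℝ} (hw : 0 ≤ w) (hA : 0 ≤ A) (hx : 0 < x) (hm : 0 ≤ m)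
    (hmx : m < x) :
    2 * w * √x - A * Real.log x - w / √x * m + (A / x * m - w / √x / x * m ^ 2) ≤
      2 * w * √(x - m) - A * Real.log (x - m) := by
  have hx' : 0 < √x := Real.sqrt_pos.2 hx
  have hsq : √x ^ 2 = x := Real.sq_sqrt hx.le
  have h1 := sub_le_sqrt_one_sub (x := m / x) (by positivity) (by rw [div_le_one hx]; exact hmx.le)
  have e1 : √(x - m) = √x * √(1 - m / x) := by
    rw [← Real.sqrt_mul hx.le]; congr 1; field_simp
  have e2 : Real.log (x - m) = Real.log x + Real.log (1 - m / x) := by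
    have h2 : 0 < 1 - m / x := by rw [sub_pos, div_lt_one hx]; exact hmx
    rw [← Real.log_mul hx.ne' h2.ne']; congr 1; field_simp
  have h3 : Real.log (1 - m / x) ≤ - (m / x) := by
    have h2 : 0 < 1 - m / x := by rw [sub_pos, div_lt_one hx]; exact hmx
    have := Real.log_le_sub_one_of_pos h2
    linarith
  have h4 : 2 * w * (√x * (1 - m / x / 2 - (m / x) ^ 2 / 2)) ≤ 2 * w * (√x * √(1 - m / x)) := by
    gcongr
  have h5 := mul_le_mul_of_nonneg_left h3 hA
  have e3 : 2 * w * (√x * (1 - m / x / 2 - (m / x) ^ 2 / 2)) =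
      2 * w * √x - w / √x * m - w / √x / x * m ^ 2 := by
    have : w / √x = w * √x / x := by
      rw [div_eq_div_iff hx'.ne' hx.ne', mul_assoc, ← sq, hsq]
    rw [this]; field_simp
  rw [e1, e2]
  have e4 : A * (-(m / x)) = -(A / x * m) := by ring
  linarith

theorem Nat.Partition.exists_exp_le_card : ∃ A M : ℝ, 0 ≤ A ∧ ∀ n : ℕ,
    Real.exp (2 * √(Real.pi ^ 2 / 6) * √n - A * Real.log n - M) ≤
      Fintype.card n.Partition := by
  set w := √(Real.pi ^ 2 / 6) with hw
  have hw2 : w ^ 2 = Real.pi ^ 2 / 6 := Real.sq_sqrt (by positivity)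
  have hw0 : 0 < w := Real.sqrt_pos.2 (by positivity)
  have hwlt : w < 2 := by
    have : w ^ 2 < 2 ^ 2 := by rw [hw2]; linarith [pi_sq_div_six_lt_four]
    exact lt_of_pow_lt_pow_left₀ 2 (by norm_num) this
  set A := 203 * Real.exp 8 with hA
  have hA0 : 0 ≤ A := by positivity
  set h : ℕ → ℝ := fun n => 2 * w * √n - A * Real.log n with hh
  set M := ∑ n ∈ Finset.range 64, |h n| with hM
  refine ⟨A, M, hA0, fun n => ?_⟩
  change Real.exp (h n - M) ≤ _
  induction n using Nat.strong_induction_on with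
  | _ n ih =>
    by_cases hn : n < 64
    · have h1 : |h n| ≤ M :=
        Finset.single_le_sum (f := fun n => |h n|) (fun _ _ => abs_nonneg _)
          (Finset.mem_range.2 hn)
      have h2 := le_abs_self (h n)
      have h3 : (1 : ℝ) ≤ Fintype.card n.Partition := by
        exact_mod_cast Fintype.card_pos (α := n.Partition)
      exact (Real.exp_le_one_iff.2 (by linarith)).trans h3
    push Not at hn
    have hnr : (64 : ℝ) ≤ n := by exact_mod_cast hn
    have hn0 : (0 : ℝ) < n := by linarith
    have hs0 : 0 < √(n : ℝ) := Real.sqrt_pos.2 hn0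
    have hss : √(n : ℝ) ^ 2 = n := Real.sq_sqrt hn0.le
    set c := w / √(n : ℝ) with hc
    have hc0 : 0 < c := by positivity
    have hcn : c ^ 2 * n = Real.pi ^ 2 / 6 := by
      rw [hc, div_pow, hss, hw2]; field_simp
    have hrec : (∑ k ∈ Finset.Icc 1 n, ∑ l ∈ (Finset.Icc 1 n).filter (fun l => k * l < n),
        (l : ℝ) * Fintype.card (n - k * l).Partition) ≤ n * Fintype.card n.Partition := by
      exact_mod_cast Nat.Partition.sum_mul_card_le n
    have hterm : Real.exp (h n - M) * ∑ k ∈ Finset.Icc 1 n,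
        ∑ l ∈ (Finset.Icc 1 n).filter (fun l => k * l < n),
        ((l : ℝ) * Real.exp (-(c * k * l)) + A / n * (l * (k * l) * Real.exp (-(c * k * l))) -
          c / n * (l * (k * l) ^ 2 * Real.exp (-(c * k * l)))) ≤
        ∑ k ∈ Finset.Icc 1 n, ∑ l ∈ (Finset.Icc 1 n).filter (fun l => k * l < n),
        (l : ℝ) * Fintype.card (n - k * l).Partition := by
      rw [Finset.mul_sum]
      refine Finset.sum_le_sum fun k hk => ?_
      rw [Finset.mul_sum]
      refine Finset.sum_le_sum fun l hl => ?_
      rw [Finset.mem_filter, Finset.mem_Icc] at hl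
      have hk1 := (Finset.mem_Icc.1 hk).1
      have hkl : 1 ≤ k * l := Nat.one_le_iff_ne_zero.2 (Nat.mul_ne_zero (by omega) (by omega))
      have h1 := ih (n - k * l) (by omega)
      have h2 := sqrt_sub_log_sub_ge (w := w) (A := A) (x := n) (m := k * l) hw0.le hA0 hn0
        (by positivity) (by exact_mod_cast hl.2)
      have e1 : ((n - k * l : ℕ) : ℝ) = n - k * l := by
        rw [Nat.cast_sub hl.2.le]; push_cast; ring
      have h3 : h n - c * k * l + (A / n * (k * l) - c / n * (k * l) ^ 2) ≤ h (n - k * l) := by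
        simp only [hh]
        rw [e1]
        calc _ = _ := by ring
          _ ≤ _ := h2
      have h4 := Real.add_one_le_exp (A / n * (k * l) - c / n * (k * l) ^ 2)
      calc _ = l * (Real.exp (h n - M) * Real.exp (-(c * k * l)) *
              (A / n * (k * l) - c / n * (k * l) ^ 2 + 1)) := by ring
        _ ≤ l * (Real.exp (h n - M) * Real.exp (-(c * k * l)) *
              Real.exp (A / n * (k * l) - c / n * (k * l) ^ 2)) := by gcongr
        _ = l * Real.exp (h n - c * k * l + (A / n * (k * l) - c / n * (k * l) ^ 2) - M) := by
            rw [← Real.exp_add, ← Real.exp_add]; congr 2; ring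
        _ ≤ l * Real.exp (h (n - k * l) - M) := by gcongr
        _ ≤ _ := by gcongr
    have h1 := sub_le_sum_sum_mul_exp (by omega) hc0 hcn
    have h2 := le_sum_sum_mul_sq_mul_exp hn hc0 hcn
    have h3 := sum_sum_mul_cube_mul_exp_le hc0 hcn
    simp only [Finset.sum_sub_distrib, Finset.sum_add_distrib, ← Finset.mul_sum] at hterm
    set S1 := ∑ k ∈ Finset.Icc 1 n, ∑ l ∈ (Finset.Icc 1 n).filter (fun l => k * l < n),
      (l : ℝ) * Real.exp (-(c * k * l))
    set S2 := ∑ k ∈ Finset.Icc 1 n, ∑ l ∈ (Finset.Icc 1 n).filter (fun l => k * l < n),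
        (l : ℝ) * (k * l) * Real.exp (-(c * k * l))
    set S3 := ∑ k ∈ Finset.Icc 1 n, ∑ l ∈ (Finset.Icc 1 n).filter (fun l => k * l < n),
        (l : ℝ) * (k * l) ^ 2 * Real.exp (-(c * k * l))
    have hE : Real.exp 8 * Real.exp (-8) = 1 := by rw [← Real.exp_add]; simp
    have h4 : 203 * √(n : ℝ) ≤ A / n * S2 := by
      calc 203 * √(n : ℝ) = A / n * (Real.exp (-8) * √n * n) := by
            rw [hA]; field_simp; linear_combination -hE
        _ ≤ _ := by gcongr
    have h5 : c / n * S3 ≤ 192 * √(n : ℝ) := by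
      calc c / n * S3 ≤ c / n * (96 * (n : ℝ) ^ 2) := by gcongr
        _ = 96 * w * √(n : ℝ) := by
            have : c * n = w * √(n : ℝ) := by rw [hc]; nth_rewrite 2 [← hss]; field_simp
            calc _ = 96 * (c * n) := by field_simp
              _ = _ := by rw [this]; ring
        _ ≤ _ := by nlinarith
    have h6 : (n : ℝ) ≤ S1 + A / n * S2 - c / n * S3 := by linarith
    have h7 := (mul_le_mul_of_nonneg_left h6 (Real.exp_pos (h n - M)).le).trans (hterm.trans hrec)
    rw [mul_comm] at h7
    exact le_of_mul_le_mul_left h7 hn0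

theorem chainWeight_le_two {p : ℕ} (hp : 2 ≤ p) (k : ℕ) {y : ℝ} (h0 : 0 ≤ y) (h1 : y < 1) :
    chainWeight p k y ≤ 2 := by
  have h2 := chain_sum_le hp k h0 h1 le_rfl
  have h3 : 0 < ∏ m : Fin (k + 1), (1 - y ^ p ^ (m : ℕ))⁻¹ := Finset.prod_pos fun m _ => by
    have : y ^ p ^ (m : ℕ) < 1 := pow_lt_one₀ h0 h1 (pow_pos (by omega) _).ne'
    exact inv_pos.2 (by linarith)
  have h4 : 0 ≤ (∏ m : Fin (k + 1), (1 - y ^ p ^ (m : ℕ))⁻¹) * (1 - chainWeight p k y / 2) := by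
    refine le_trans (Finset.sum_nonneg fun c _ => ?_) h2
    split_ifs <;> positivity
  have := nonneg_of_mul_nonneg_right h4 h3
  linarith

namespace Nat.Partition

theorem exists_exp_pi_sq_div_le : ∃ A M : ℝ, 0 ≤ A ∧ ∀ N : ℕ, 0 < N → ∀ c : ℝ, 0 < c →
    c ^ 2 * N = Real.pi ^ 2 / 6 → Real.exp (Real.pi ^ 2 / 6 / c) ≤
      Real.exp (-c) ^ N * (Fintype.card N.Partition * Real.exp (A * Real.log N + M)) := by
  obtain ⟨A, M, hA, h⟩ := exists_exp_le_card
  refine ⟨A, M, hA, fun N hN c hc hcN => ?_⟩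
  have hN' : (0 : ℝ) < N := by exact_mod_cast hN
  have e1 : √(Real.pi ^ 2 / 6) * √N = c * N := by
    rw [← Real.sqrt_mul (by positivity), ← hcN,
      show c ^ 2 * (N : ℝ) * N = (c * N) ^ 2 by ring, Real.sqrt_sq (by positivity)]
  have e2 : Real.pi ^ 2 / 6 / c = c * N := by rw [← hcN]; field_simp
  have h1 := h N
  rw [mul_assoc, e1] at h1
  calc _ = Real.exp (-c) ^ N * (Real.exp (2 * (c * N) - A * Real.log N - M) *
        Real.exp (A * Real.log N + M)) := by
        rw [e2, ← Real.exp_nat_mul, ← Real.exp_add, ← Real.exp_add]; congr 1; ring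
    _ ≤ _ := by gcongr

variable {N : ℕ} {c R : ℝ}

theorem sum_prod_le_card_mul (hc : 0 < c)
    (hR : Real.exp (Real.pi ^ 2 / 6 / c) ≤ Real.exp (-c) ^ N * (Fintype.card N.Partition * R))
    (S : Finset ℕ) (hS : S ⊆ Finset.Icc 1 N) (hSN : ∑ M ∈ S, M ≤ N) :
    ∑ π : (N - ∑ M ∈ S, M).Partition, ∏ M ∈ S, ((M : ℝ) * (π.parts.count M + 1)) ≤
      Fintype.card N.Partition * R *
        ∏ M ∈ S, ((M : ℝ) * Real.exp (-c) ^ M * (1 - Real.exp (-c) ^ M)⁻¹) := by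
  set q := Real.exp (-c) with hq
  have h0 : 0 < q := Real.exp_pos _
  have h1 : q < 1 := by rw [hq, Real.exp_lt_one_iff]; linarith
  have hlt : ∀ M ∈ S, q ^ M < 1 := fun M hM =>
    pow_lt_one₀ h0.le h1 (by have := (Finset.mem_Icc.1 (hS hM)).1; omega)
  have h2 := pow_mul_sum_prod_le h0 h1 (Nat.sub_le N (∑ M ∈ S, M)) S hS
  have h3 := (prod_inv_one_sub_exp_le hc N).trans hR
  have hP : 0 ≤ ∏ M ∈ S, ((M : ℝ) * (1 - q ^ M)⁻¹) := Finset.prod_nonneg fun M hM => by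
    have := hlt M hM
    exact mul_nonneg (Nat.cast_nonneg _) (inv_nonneg.2 (by linarith))
  have h4 := h2.trans (mul_le_mul_of_nonneg_right h3 hP)
  have e1 : q ^ N = q ^ (N - ∑ M ∈ S, M) * ∏ M ∈ S, q ^ M := by
    rw [Finset.prod_pow_eq_pow_sum, ← pow_add, Nat.sub_add_cancel hSN]
  rw [e1, mul_assoc, mul_assoc] at h4
  refine (le_of_mul_le_mul_left h4 (by positivity)).trans (le_of_eq ?_)
  rw [mul_left_comm, ← Finset.prod_mul_distrib]
  rw [mul_assoc, mul_assoc]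
  congr 2
  exact Finset.prod_congr rfl fun M _ => by ring

theorem card_filter_chain_le (hc : 0 < c)
    (hR : Real.exp (Real.pi ^ 2 / 6 / c) ≤ Real.exp (-c) ^ N * (Fintype.card N.Partition * R))
    {k p : ℕ} (hp : 2 ≤ p) (hN : 2 * p ^ (k + 1) ≤ N) (S : Finset ℕ)
    (hmem : ∀ j ∈ S, ∀ m : Fin (k + 1), j * p ^ (m : ℕ) ∈ Finset.Icc 1 N)
    (hinj : ∀ j ∈ S, ∀ j' ∈ S, ∀ m m' : Fin (k + 1), j * p ^ (m : ℕ) = j' * p ^ (m' : ℕ) →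
      j = j' ∧ m = m') {w : ℝ} (hw : ∀ j ∈ S, w ≤ chainWeight p k (Real.exp (-c) ^ j))
    (J : ℕ) :
    ((Finset.univ.filter fun π : N.Partition => (S.filter fun j =>
        p ^ (k + 1) ≤ ∑ m : Fin (k + 1), π.parts.count (j * p ^ (m : ℕ)) * p ^ (m : ℕ)).card
          < J).card : ℝ) ≤
      Fintype.card N.Partition * R * Real.exp (J - w / 2 * S.card) := by
  set q := Real.exp (-c) with hq
  have h0 : 0 < q := Real.exp_pos _
  have h1 : q < 1 := by rw [hq, Real.exp_lt_one_iff]; linarith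
  have h2 := pow_mul_card_filter_chain_le h0 h1 hp hN S hmem hinj J
  have h3 := (prod_inv_one_sub_exp_le hc N).trans hR
  have hy : ∀ j ∈ S, q ^ j < 1 := fun j hj => by
    have := (Finset.mem_Icc.1 (hmem j hj 0)).1
    rw [Fin.val_zero, pow_zero, mul_one] at this
    exact pow_lt_one₀ h0.le h1 (by omega)
  have h4 : ∏ j ∈ S, (1 - chainWeight p k (q ^ j) / 2) ≤ Real.exp (-(w / 2 * S.card)) := by
    calc _ ≤ ∏ j ∈ S, Real.exp (-(w / 2)) := by
          refine Finset.prod_le_prod (fun j hj => ?_) fun j hj => ?_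
          · have := chainWeight_le_two hp k (by positivity) (hy j hj)
            linarith
          · have h5 := Real.add_one_le_exp (-(w / 2))
            have h6 := hw j hj
            linarith
      _ = _ := by rw [Finset.prod_const, ← Real.exp_nat_mul]; congr 1; ring
  have h5 : (2 : ℝ) ^ J ≤ Real.exp J := by
    rw [← mul_one (J : ℝ), Real.exp_nat_mul]
    have := Real.add_one_le_exp 1
    gcongr
    linarith
  have hR0 : 0 ≤ Fintype.card N.Partition * R :=
    (pos_of_mul_pos_right ((Real.exp_pos _).trans_le hR) (by positivity)).le
  have hprod0 : 0 ≤ ∏ i ∈ Finset.Icc 1 N, (1 - q ^ i)⁻¹ := Finset.prod_nonneg fun i hi => by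
    have : q ^ i < 1 := pow_lt_one₀ h0.le h1 (by have := (Finset.mem_Icc.1 hi).1; omega)
    exact inv_nonneg.2 (by linarith)
  refine le_of_mul_le_mul_left (h2.trans ?_) (pow_pos h0 N)
  calc _ ≤ Real.exp J * ((q ^ N * (Fintype.card N.Partition * R)) *
        Real.exp (-(w / 2 * S.card))) := by
        refine mul_le_mul h5 (mul_le_mul h3 h4 ?_ (by positivity)) ?_ (by positivity)
        · exact Finset.prod_nonneg fun j hj => by
            have := chainWeight_le_two hp k (by positivity) (hy j hj)
            linarith
        · exact mul_nonneg hprod0 (Finset.prod_nonneg fun j hj => by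
            have := chainWeight_le_two hp k (by positivity) (hy j hj)
            linarith)
    _ = _ := by rw [sub_eq_add_neg, Real.exp_add]; ring

end Nat.Partition

theorem mul_sum_count_mul_pow_eq (s : Multiset ℕ) {j p : ℕ} (hj : 0 < j) (hp : 2 ≤ p) (k : ℕ) :
    (s.filter fun l => ∃ i < k, l = j * p ^ i).sum =
      j * ∑ m : Fin k, s.count (j * p ^ (m : ℕ)) * p ^ (m : ℕ) := by
  classical
  rw [Finset.sum_multiset_count_of_subset (s.filter fun l => ∃ i < k, l = j * p ^ i)
    ((Finset.range k).image fun i => j * p ^ i)]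
  · rw [Finset.sum_image, Finset.mul_sum, Finset.sum_range]
    · refine Finset.sum_congr rfl fun m _ => ?_
      rw [Multiset.count_filter_of_pos ⟨m, m.2, rfl⟩, smul_eq_mul]
      ring
    · intro i _ i' _ h
      exact Nat.pow_right_injective hp (Nat.eq_of_mul_eq_mul_left hj h)
  · intro l hl
    rw [Multiset.mem_toFinset, Multiset.mem_filter] at hl
    obtain ⟨i, hi, rfl⟩ := hl.2
    exact Finset.mem_image.2 ⟨i, Finset.mem_range.2 hi, rfl⟩

theorem mul_pow_injective_of_lt_two_mul {p j j' m m' a b : ℕ} (hp : 2 ≤ p) (hab : b ≤ 2 * a)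
    (hj : j ∈ Finset.Ico a b) (hj' : j' ∈ Finset.Ico a b) (h : j * p ^ m = j' * p ^ m') :
    j = j' ∧ m = m' := by
  rw [Finset.mem_Ico] at hj hj'
  have hpos : 0 < p := by omega
  have key : ∀ {x y u v : ℕ}, a ≤ y → x < b → x * p ^ u = y * p ^ v → v ≤ u := by
    intro x y u v hy hx hxy
    by_contra hlt
    push Not at hlt
    obtain ⟨d, rfl⟩ := Nat.exists_eq_add_of_lt hlt
    have h1 : x * p ^ u = y * p ^ (d + 1) * p ^ u := by rw [hxy]; ring
    have h2 := Nat.eq_of_mul_eq_mul_right (pow_pos hpos u) h1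
    have h3 : 2 ≤ p ^ (d + 1) := hp.trans (Nat.le_self_pow (by omega) p)
    have h4 : y * 2 ≤ y * p ^ (d + 1) := Nat.mul_le_mul_left _ h3
    omega
  have hm : m = m' := le_antisymm (key hj.1 hj'.2 h.symm) (key hj'.1 hj.2 h)
  subst hm
  exact ⟨Nat.eq_of_mul_eq_mul_right (pow_pos hpos m) h, rfl⟩

theorem exists_finset_forall_card_filter_not_dvd_le {N : ℕ} {c R : ℝ} (hc : 0 < c)
    (hR : Real.exp (Real.pi ^ 2 / 6 / c) ≤ Real.exp (-c) ^ N * (Fintype.card N.Partition * R))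
    {p k j₀ n₀ : ℕ} (hp : p.Prime) (hn₀ : 0 < n₀) (hnj : n₀ ≤ j₀)
    (hN : (j₀ + n₀) * p ^ (k + 1) ≤ N) {a w : ℝ}
    (ha : ∀ j ∈ Finset.Ico j₀ (j₀ + n₀), ((j * p ^ (k + 1) : ℕ) : ℝ) *
      Real.exp (-c) ^ (j * p ^ (k + 1)) * (1 - Real.exp (-c) ^ (j * p ^ (k + 1)))⁻¹ ≤
        Real.exp (-a))
    (hw : ∀ j ∈ Finset.Ico j₀ (j₀ + n₀), w ≤ chainWeight p k (Real.exp (-c) ^ j)) (J : ℕ) :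
    ∃ B : Finset N.Partition,
      (B.card : ℝ) ≤ Fintype.card N.Partition * R * Real.exp (J - w / 2 * n₀) ∧
      ∀ F : Finset (Equiv.Perm (Fin N) → ℤ), (∀ χ ∈ F, IsIrreducibleIntCharacter χ) →
        ∀ (g : Equiv.Perm (Fin N)) (π : N.Partition), g.cycleType = π.parts.filter (2 ≤ ·) →
          π ∉ B → ((F.filter fun χ => ¬ (p : ℤ) ∣ χ g).card : ℝ) ≤
            Fintype.card N.Partition * R * Real.exp (-(a * J)) := by
  classical
  have hp2 := hp.two_le
  have hpos := hp.pos
  have hR0 : 0 ≤ Fintype.card N.Partition * R :=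
    (pos_of_mul_pos_right ((Real.exp_pos _).trans_le hR) (by positivity)).le
  set T := Finset.Ico j₀ (j₀ + n₀) with hT
  have hmem : ∀ j ∈ T, ∀ m ≤ k + 1, j * p ^ m ∈ Finset.Icc 1 N := by
    intro j hj m hm
    rw [hT, Finset.mem_Ico] at hj
    rw [Finset.mem_Icc]
    refine ⟨Nat.mul_pos (by omega) (pow_pos hpos m), le_trans ?_ hN⟩
    exact Nat.mul_le_mul hj.2.le (Nat.pow_le_pow_right hpos hm)
  have hinj : ∀ j ∈ T, ∀ j' ∈ T, ∀ m m' : ℕ, j * p ^ m = j' * p ^ m' → j = j' ∧ m = m' :=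
    fun j hj j' hj' m m' h => mul_pow_injective_of_lt_two_mul hp2 (by omega) hj hj' h
  refine ⟨Finset.univ.filter fun π : N.Partition => (T.filter fun j =>
        p ^ (k + 1) ≤ ∑ m : Fin (k + 1), π.parts.count (j * p ^ (m : ℕ)) * p ^ (m : ℕ)).card
          < J, ?_, fun F hF g π hg hπ => ?_⟩
  · have h2N : 2 * p ^ (k + 1) ≤ N :=
      (Nat.mul_le_mul_right _ (show 2 ≤ j₀ + n₀ by omega)).trans hN
    have := Nat.Partition.card_filter_chain_le hc hR hp2 h2N T
      (fun j hj m => hmem j hj m m.2.le)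
      (fun j hj j' hj' m m' h => by
        obtain ⟨h1, h2⟩ := hinj j hj j' hj' m m' h
        exact ⟨h1, Fin.ext h2⟩) hw J
    rwa [hT, Nat.card_Ico, Nat.add_sub_cancel_left] at this
  · simp only [Finset.mem_filter, Finset.mem_univ, true_and, not_lt] at hπ
    obtain ⟨S, hS, hcard⟩ := Finset.exists_subset_card_eq hπ
    have hST : S ⊆ T := hS.trans (Finset.filter_subset _ _)
    have hj0 : ∀ j ∈ S, 0 < j := fun j hj => by
      have := Finset.mem_Ico.1 (hST hj)
      omega
    obtain ⟨h1, h2⟩ := IsIrreducibleIntCharacter.card_filter_not_dvd_le F hF g hg π.parts_sum hp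
      (k := k + 1) (by omega) S hj0
      (fun j hj j' hj' hne i _ i' _ h => hne (hinj j (hST hj) j' (hST hj') i i' h).1)
      (fun j hj => by
        rw [mul_sum_count_mul_pow_eq π.parts (hj0 j hj) hp2]
        exact Nat.mul_le_mul_left _ (Finset.mem_filter.1 (hS hj)).2)
    have hinjS : Set.InjOn (fun j => j * p ^ (k + 1)) S := fun j hj j' hj' h =>
      (hinj j (hST hj) j' (hST hj') _ _ h).1
    have e1 : ∑ M ∈ S.image (fun j => j * p ^ (k + 1)), M = ∑ j ∈ S, j * p ^ (k + 1) :=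
      Finset.sum_image hinjS
    have h3 := Nat.Partition.sum_prod_le_card_mul hc hR (S.image fun j => j * p ^ (k + 1))
      (by
        intro M hM
        obtain ⟨j, hj, rfl⟩ := Finset.mem_image.1 hM
        exact hmem j (hST hj) _ le_rfl) (by rw [e1]; exact h1)
    rw [e1] at h3
    simp_rw [Finset.prod_image hinjS] at h3
    calc _ ≤ ((∑ ν : (N - ∑ j ∈ S, j * p ^ (k + 1)).Partition, ∏ j ∈ S,
          (j * p ^ (k + 1) * (ν.parts.count (j * p ^ (k + 1)) + 1)) : ℕ) : ℝ) := by
          exact_mod_cast h2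
      _ ≤ _ := by
          refine le_trans (le_of_eq ?_) h3
          push_cast
          rfl
      _ ≤ Fintype.card N.Partition * R * ∏ j ∈ S, Real.exp (-a) := by
          refine mul_le_mul_of_nonneg_left (Finset.prod_le_prod (fun j hj => ?_)
            fun j hj => ha j (hST hj)) hR0
          have : Real.exp (-c) ^ (j * p ^ (k + 1)) ≤ 1 :=
            pow_le_one₀ (Real.exp_pos _).le (Real.exp_le_one_iff.2 (by linarith))
          have h4 : 0 ≤ (1 - Real.exp (-c) ^ (j * p ^ (k + 1)))⁻¹ :=
            inv_nonneg.2 (by linarith)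
          positivity
      _ = _ := by
          rw [Finset.prod_const, hcard, ← Real.exp_nat_mul]
          congr 2; ring

theorem Real.exp_neg_le_one_div_one_add {x : ℝ} (hx : 0 ≤ x) : Real.exp (-x) ≤ 1 / (1 + x) := by
  rw [Real.exp_neg, ← one_div]
  have := Real.add_one_le_exp x
  exact one_div_le_one_div_of_le (by linarith) (by linarith)

theorem le_chainWeight {p k : ℕ} (hp : 2 ≤ p) {u D : ℝ} (hD : u * p ^ (k + 1) = D) (hD1 : 1 ≤ D)
    (hk : 8 * p * (k + 1) ≤ D) :
    Real.exp (-D) / 2 * (4 * p) ^ k / D ^ 4 ≤ chainWeight p k (Real.exp (-u)) := by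
  classical
  have hpr : (2 : ℝ) ≤ p := by exact_mod_cast hp
  have hp0 : (0 : ℝ) < p := by linarith
  have e1 : Real.exp (-u) ^ p ^ (k + 1) = Real.exp (-D) := by
    rw [← Real.exp_nat_mul, ← hD]; congr 1; push_cast; ring
  have e2 : ∀ m : Fin k, Real.exp (-u) ^ p ^ ((m : ℕ) + 1) = Real.exp (-(D / p ^ (k - m))) := by
    intro m
    rw [← Real.exp_nat_mul, ← hD,
      show k + 1 = (m : ℕ) + 1 + (k - m) by omega, pow_add _ ((m : ℕ) + 1)]
    congr 1; push_cast; field_simp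
  rw [chainWeight, e1]
  simp_rw [e2]
  set f : Fin k → ℝ := fun m => ((p ^ (k - m) / (k + 1) + 1 : ℕ) : ℝ) *
    (1 - Real.exp (-(D / p ^ (k - m)))) with hf
  set s : Finset (Fin k) := Finset.univ.filter fun m => (p : ℝ) ^ (k - m) < D with hs
  have hf0 : ∀ m, 0 ≤ f m := fun m => by
    have : Real.exp (-(D / p ^ (k - m))) ≤ 1 := Real.exp_le_one_iff.2 (by
      have : 0 ≤ D / (p : ℝ) ^ (k - m) := by positivity
      linarith)
    exact mul_nonneg (Nat.cast_nonneg _) (by linarith)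
  have h1 : ∀ m, 4 * (p : ℝ) ≤ f m * (if m ∈ s then (p : ℝ) ^ 4 else 1) := by
    intro m
    have hP : (0 : ℝ) < (p : ℝ) ^ (k - m) := by positivity
    have hx0 : 0 ≤ D / (p : ℝ) ^ (k - m) := by positivity
    have h2 := Real.exp_neg_le_one_div_one_add hx0
    set x := D / (p : ℝ) ^ (k - m) with hx
    split_ifs with hm
    · have hm' := (Finset.mem_filter.1 hm).2
      have hx1 : 1 < x := by rwa [hx, one_lt_div hP]
      have h3 : (1 : ℝ) / (1 + x) ≤ 1 / 2 := one_div_le_one_div_of_le (by norm_num) (by linarith)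
      have h4 : 1 / 2 ≤ f m := by
        have : (1 : ℝ) ≤ ((p ^ (k - m) / (k + 1) + 1 : ℕ) : ℝ) := by
          exact_mod_cast Nat.le_add_left _ _
        simp only [hf]
        nlinarith
      have h5 : 8 * (p : ℝ) ≤ p ^ 4 := by
        have : (2 : ℝ) ^ 3 ≤ p ^ 3 := by gcongr
        nlinarith
      nlinarith
    · have hm' : D ≤ (p : ℝ) ^ (k - m) := by
        by_contra h
        exact hm (Finset.mem_filter.2 ⟨Finset.mem_univ _, not_le.1 h⟩)
      have hx1 : x ≤ 1 := by rwa [hx, div_le_one hP]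
      have h3 : 1 / (1 + x) ≤ 1 - x / 2 := by
        rw [div_le_iff₀ (by linarith)]; nlinarith
      have h4 : (p : ℝ) ^ (k - m) / (k + 1) ≤ ((p ^ (k - m) / (k + 1) + 1 : ℕ) : ℝ) := by
        rw [div_le_iff₀ (by positivity)]
        have := (Nat.lt_mul_div_succ (p ^ (k - m)) (show 0 < k + 1 by omega)).le
        rw [mul_comm] at this
        exact_mod_cast this
      rw [mul_one]
      calc 4 * (p : ℝ) ≤ D / (2 * (k + 1)) := by
            rw [le_div_iff₀ (by positivity)]; linarith
        _ = (p : ℝ) ^ (k - m) / (k + 1) * (x / 2) := by rw [hx]; field_simp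
        _ ≤ _ := mul_le_mul h4 (by linarith) (by positivity) (Nat.cast_nonneg _)
  have h2 : ∏ m, (if m ∈ s then (p : ℝ) ^ 4 else 1) ≤ D ^ 4 := by
    rw [Finset.prod_ite_mem, Finset.univ_inter, Finset.prod_const, pow_right_comm]
    refine pow_le_pow_left₀ (by positivity) ?_ 4
    rcases s.eq_empty_or_nonempty with h | h
    · rw [h]; simpa using hD1
    · have h3 : s ⊆ Finset.Ici (s.min' h) := fun m hm => Finset.mem_Ici.2 (s.min'_le m hm)
      have h4 := Finset.card_le_card h3
      rw [Fin.card_Ici] at h4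
      have h5 := (Finset.mem_filter.1 (s.min'_mem h)).2
      exact (pow_le_pow_right₀ (by linarith) h4).trans h5.le
  have h3 : (4 * (p : ℝ)) ^ k / D ^ 4 ≤ ∏ m, f m := by
    rw [div_le_iff₀ (by positivity)]
    calc (4 * (p : ℝ)) ^ k = ∏ m : Fin k, 4 * (p : ℝ) := by
          rw [Finset.prod_const, Finset.card_univ, Fintype.card_fin]
      _ ≤ ∏ m, f m * (if m ∈ s then (p : ℝ) ^ 4 else 1) :=
          Finset.prod_le_prod (fun _ _ => by positivity) fun m _ => h1 m
      _ = (∏ m, f m) * ∏ m, (if m ∈ s then (p : ℝ) ^ 4 else 1) := Finset.prod_mul_distrib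
      _ ≤ _ := mul_le_mul_of_nonneg_left h2 (Finset.prod_nonneg fun m _ => hf0 m)
  rw [mul_div_assoc]
  refine mul_le_mul ?_ h3 (by positivity) ?_
  · have h4 := Real.exp_neg_le_one_div_one_add (x := D) (by linarith)
    have h5 : (1 : ℝ) / (1 + D) ≤ 1 / 2 := one_div_le_one_div_of_le (by norm_num) (by linarith)
    have h6 := Real.exp_pos (-D)
    nlinarith
  · have h6 := Real.exp_pos (-D)
    have : Real.exp (-D) ≤ 1 := Real.exp_le_one_iff.2 (by linarith)
    exact mul_nonneg h6.le (by linarith)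

theorem exists_chain_parameters {p : ℕ} (hp : 2 ≤ p) {Λ : ℝ} (hΛ : 100 * p ≤ Λ) :
    ∃ (k j₀ n₀ : ℕ) (w : ℝ), 0 < n₀ ∧ n₀ ≤ j₀ ∧
      ((j₀ + n₀) * p ^ (k + 1) : ℝ) ≤ 2 * Λ * Real.exp Λ ∧
      (∀ j ∈ Finset.Ico j₀ (j₀ + n₀), ((j * p ^ (k + 1) : ℕ) : ℝ) *
        Real.exp (-Real.exp (-Λ)) ^ (j * p ^ (k + 1)) *
          (1 - Real.exp (-Real.exp (-Λ)) ^ (j * p ^ (k + 1)))⁻¹ ≤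
            4 * Λ * Real.exp (-(Λ / p / 100))) ∧
      (∀ j ∈ Finset.Ico j₀ (j₀ + n₀), w ≤ chainWeight p k (Real.exp (-Real.exp (-Λ)) ^ j)) ∧
      Real.exp (Λ / p / 10 - 4) / (64 * p * Λ ^ 4) ≤ w * n₀ := by
  have hpr : (2 : ℝ) ≤ p := by exact_mod_cast hp
  have hp0 : (0 : ℝ) < p := by linarith
  have hΛ0 : 200 ≤ Λ := by linarith
  set x := Λ / p with hx
  have hx100 : 100 ≤ x := by rwa [hx, le_div_iff₀ hp0]
  have hxΛ : x * p = Λ := by rw [hx]; field_simp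
  set D₀ := Λ + x / 100 with hD₀
  have hD₀Λ : D₀ + 2 ≤ 2 * Λ := by
    nlinarith
  have hD₀1 : 1 ≤ D₀ := by linarith
  set K := ⌊D₀ / (8 * p)⌋₊ with hK
  have hKle : (K : ℝ) ≤ D₀ / (8 * p) := Nat.floor_le (by positivity)
  have hKge : D₀ / (8 * p) < K + 1 := Nat.lt_floor_add_one _
  have hxK : x / 8 ≤ D₀ / (8 * p) := by
    rw [le_div_iff₀ (by positivity)]
    nlinarith
  have hK0 : 0 < K := by
    have : (0 : ℝ) < K := by linarith
    exact_mod_cast this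
  obtain ⟨k, hk⟩ : ∃ k, K = k + 1 := ⟨K - 1, by omega⟩
  have hkr : (K : ℝ) = k + 1 := by rw [hk]; push_cast; ring
  set c := Real.exp (-Λ) with hc
  have hc0 : 0 < c := Real.exp_pos _
  have hcΛ : c * Real.exp Λ = 1 := by rw [hc, ← Real.exp_add]; simp
  set t := c * p ^ (k + 1) with ht
  have ht0 : 0 < t := by positivity
  have hpe : (p : ℝ) ≤ Real.exp p := by
    have := Real.add_one_le_exp (p : ℝ)
    linarith
  have hpK : (p : ℝ) ^ (k + 1) ≤ Real.exp (D₀ / 8) := by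
    calc (p : ℝ) ^ (k + 1) ≤ Real.exp p ^ (k + 1) := by gcongr
      _ = Real.exp (K * p) := by rw [← Real.exp_nat_mul, hkr]; push_cast; rfl
      _ ≤ _ := by
          rw [Real.exp_le_exp]
          rw [le_div_iff₀ (by positivity)] at hKle
          linarith
  have ht2 : t ≤ 1 / 2 := by
    calc t ≤ c * Real.exp (D₀ / 8) := mul_le_mul_of_nonneg_left hpK hc0.le
      _ = Real.exp (-(Λ - D₀ / 8)) := by rw [hc, ← Real.exp_add]; congr 1; ring
      _ ≤ 1 / (1 + (Λ - D₀ / 8)) := Real.exp_neg_le_one_div_one_add (by linarith)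
      _ ≤ 1 / 2 := one_div_le_one_div_of_le (by norm_num) (by linarith)
  set n₀ := ⌊1 / t⌋₊ with hn₀
  set j₀ := ⌈D₀ / t⌉₊ with hj₀
  have h2t : 2 ≤ 1 / t := by rw [le_div_iff₀ ht0]; linarith
  have hn₀le : (n₀ : ℝ) ≤ 1 / t := Nat.floor_le (by positivity)
  have hn₀ge : 1 / t < n₀ + 1 := Nat.lt_floor_add_one _
  have hj₀ge : D₀ / t ≤ j₀ := Nat.le_ceil _
  have hj₀le : (j₀ : ℝ) < D₀ / t + 1 := Nat.ceil_lt_add_one (by positivity)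
  have hn₀' : 1 / (2 * t) ≤ n₀ := by
    have : 1 / (2 * t) = 1 / t / 2 := by field_simp
    linarith
  have hub : (j₀ + n₀ : ℝ) * t ≤ D₀ + 2 := by
    have h1 : (n₀ : ℝ) * t ≤ 1 := by rwa [le_div_iff₀ ht0] at hn₀le
    have h2 : (j₀ : ℝ) * t < D₀ + t := by
      have := mul_lt_mul_of_pos_right hj₀le ht0
      rwa [add_mul, div_mul_cancel₀ _ ht0.ne', one_mul] at this
    linarith
  have hD : ∀ j ∈ Finset.Ico j₀ (j₀ + n₀), D₀ ≤ j * t ∧ j * t ≤ D₀ + 2 := by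
    intro j hj
    rw [Finset.mem_Ico] at hj
    have h1 : (j₀ : ℝ) ≤ j := by exact_mod_cast hj.1
    have h2 : (j : ℝ) ≤ j₀ + n₀ := by exact_mod_cast hj.2.le
    refine ⟨?_, le_trans (by gcongr) hub⟩
    rw [div_le_iff₀ ht0] at hj₀ge
    exact hj₀ge.trans (by gcongr)
  have hkD : 8 * p * ((k : ℝ) + 1) ≤ D₀ := by
    rw [hkr, le_div_iff₀ (by positivity)] at hKle
    linarith
  refine ⟨k, j₀, n₀, Real.exp (-(D₀ + 2)) / 2 * (4 * p) ^ k / (D₀ + 2) ^ 4, ?_, ?_, ?_, ?_, ?_, ?_⟩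
  · have : (0 : ℝ) < n₀ := by linarith
    exact_mod_cast this
  · have : (n₀ : ℝ) ≤ j₀ := hn₀le.trans (le_trans (by gcongr) hj₀ge)
    exact_mod_cast this
  · calc ((j₀ + n₀) * p ^ (k + 1) : ℝ) = (j₀ + n₀ : ℝ) * t * Real.exp Λ := by
          rw [ht]; linear_combination (-((j₀ + n₀ : ℝ) * p ^ (k + 1))) * hcΛ
      _ ≤ 2 * Λ * Real.exp Λ :=
          mul_le_mul_of_nonneg_right (hub.trans hD₀Λ) (Real.exp_pos _).le
  · intro j hj
    obtain ⟨h1, h2⟩ := hD j hj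
    have e1 : Real.exp (-c) ^ (j * p ^ (k + 1)) = Real.exp (-(j * t)) := by
      rw [← Real.exp_nat_mul]; congr 1; rw [ht]; push_cast; ring
    rw [e1]
    have h3 : Real.exp (-(j * t)) ≤ 1 / 2 :=
      (Real.exp_neg_le_one_div_one_add (by linarith)).trans
        (one_div_le_one_div_of_le (by norm_num) (by linarith))
    have h4 : (1 - Real.exp (-(j * t)))⁻¹ ≤ 2 := by
      rw [inv_le_comm₀ (by linarith) (by norm_num)]; linarith
    have h5 : 0 ≤ (1 - Real.exp (-(j * t)))⁻¹ := inv_nonneg.2 (by linarith)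
    have h6 : j * t ≤ 2 * Λ := h2.trans hD₀Λ
    calc _ ≤ ((j * p ^ (k + 1) : ℕ) : ℝ) * Real.exp (-D₀) * 2 := by gcongr
      _ = (j * t) * Real.exp Λ * Real.exp (-D₀) * 2 := by
          rw [ht]; push_cast
          linear_combination (-(j * p ^ (k + 1) * Real.exp (-D₀) * 2 : ℝ)) * hcΛ
      _ ≤ 2 * Λ * Real.exp Λ * Real.exp (-D₀) * 2 := by gcongr
      _ = 4 * Λ * (Real.exp Λ * Real.exp (-D₀)) := by ring
      _ = _ := by rw [← Real.exp_add]; congr 2; rw [hD₀]; ring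
  · intro j hj
    obtain ⟨h1, h2⟩ := hD j hj
    have e1 : Real.exp (-c) ^ j = Real.exp (-(j * c)) := by
      rw [← Real.exp_nat_mul]; congr 1; ring
    rw [e1]
    refine le_trans ?_ (le_chainWeight hp (D := j * t) (by rw [ht]; ring) (by linarith)
      (by linarith))
    have : 0 < j * t := by linarith
    gcongr
  · have h1 : Real.exp (x / 8 - 2) ≤ 4 ^ k := by
      calc Real.exp (x / 8 - 2) ≤ Real.exp (k * 1) := by
            rw [Real.exp_le_exp]; linarith
        _ = Real.exp 1 ^ k := by rw [Real.exp_nat_mul]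
        _ ≤ 4 ^ k := by
            have := Real.exp_one_lt_d9
            gcongr
            linarith
    calc _ ≤ Real.exp (x / 8 - x / 100 - 4) / (64 * p * Λ ^ 4) := by
          gcongr
          linarith
      _ = Real.exp (-(x / 100 + 2)) * Real.exp (x / 8 - 2) / (4 * p * (2 * Λ) ^ 4) := by
          rw [← Real.exp_add, show -(x / 100 + 2) + (x / 8 - 2) = x / 8 - x / 100 - 4 by ring]
          rw [show 4 * p * (2 * Λ) ^ 4 = 64 * p * Λ ^ 4 by ring]
      _ ≤ Real.exp (-(x / 100 + 2)) * 4 ^ k / (4 * p * (D₀ + 2) ^ 4) := by gcongr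
      _ = Real.exp (-(D₀ + 2)) / 2 * (4 * p) ^ k / (D₀ + 2) ^ 4 * (1 / (2 * t)) := by
          have e1 : Real.exp (-(x / 100 + 2)) = Real.exp (-(D₀ + 2)) * Real.exp Λ := by
            rw [← Real.exp_add]; congr 1; rw [hD₀]; ring
          rw [e1, ht, mul_pow]
          have : 0 < D₀ + 2 := by linarith
          field_simp
          linear_combination (4 * (p : ℝ) * p ^ k) * hcΛ
      _ ≤ _ := by gcongr

theorem exists_finset_card_le_of_prime_le {A M : ℝ} (hA : 0 ≤ A)
    {N p : ℕ} (hp : p.Prime) {c : ℝ} (hc : 0 < c) (hcN : c ^ 2 * N = Real.pi ^ 2 / 6)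
    (hR : Real.exp (Real.pi ^ 2 / 6 / c) ≤
      Real.exp (-c) ^ N * (Fintype.card N.Partition * Real.exp (A * Real.log N + M)))
    (hL : 2 * A + 12 ≤ Real.log N) (hℓ : A + 420 ≤ Real.log (Real.log N))
    (hpN : (p : ℝ) ≤ Real.log N / Real.log (Real.log N) ^ 2) :
    ∃ B : Finset N.Partition,
      (B.card : ℝ) ≤ Fintype.card N.Partition * Real.exp (M - 4 * Real.log N) ∧
      ∀ F : Finset (Equiv.Perm (Fin N) → ℤ), (∀ χ ∈ F, IsIrreducibleIntCharacter χ) →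
        ∀ (g : Equiv.Perm (Fin N)) (π : N.Partition), g.cycleType = π.parts.filter (2 ≤ ·) →
          π ∉ B → ((F.filter fun χ => ¬ (p : ℤ) ∣ χ g).card : ℝ) ≤
            Fintype.card N.Partition * Real.exp (M - 4 * Real.log N) := by
  set L := Real.log N with hLdef
  set ℓ := Real.log L with hℓdef
  have hL0 : 0 < L := by linarith
  have hN0 : (0 : ℝ) < N := by
    rcases Nat.eq_zero_or_pos N with h | h
    · rw [h] at hLdef; simp at hLdef; linarith
    · exact_mod_cast h
  have hLN : Real.exp L = N := Real.exp_log hN0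
  have hℓL : Real.exp ℓ = L := Real.exp_log hL0
  have hp2 : (2 : ℝ) ≤ p := by exact_mod_cast hp.two_le
  have hp0 : (0 : ℝ) < p := by linarith
  have hz1 := one_lt_pi_sq_div_six
  have hz4 := pi_sq_div_six_lt_four
  set Λ := -Real.log c with hΛ
  have hcΛ : Real.exp (-Λ) = c := by rw [hΛ, neg_neg, Real.exp_log hc]
  have hΛL : 2 * Λ = L - Real.log (Real.pi ^ 2 / 6) := by
    rw [← hcN, Real.log_mul (by positivity) hN0.ne', Real.log_pow]
    push_cast; ring
  have hlogz0 : 0 ≤ Real.log (Real.pi ^ 2 / 6) := Real.log_nonneg hz1.le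
  have hlogz : Real.log (Real.pi ^ 2 / 6) ≤ 4 := by
    have := Real.log_le_sub_one_of_pos (show 0 < Real.pi ^ 2 / 6 by linarith)
    linarith
  have hΛ1 : L / 4 ≤ Λ := by linarith
  have hΛ2 : Λ ≤ L / 2 := by linarith
  have hℓ0 : 0 < ℓ := by linarith
  have hpℓ : p * ℓ ^ 2 ≤ L := by rwa [le_div_iff₀ (by positivity)] at hpN
  have hx : ℓ ^ 2 / 4 ≤ Λ / p := by
    rw [le_div_iff₀ hp0]; linarith
  have hpL : (p : ℝ) ≤ L := by
    refine le_trans ?_ hpℓ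
    exact le_mul_of_one_le_right hp0.le (by nlinarith)
  have hℓ2 : (A + 420) * ℓ ≤ ℓ ^ 2 := by
    rw [sq]; exact mul_le_mul_of_nonneg_right hℓ hℓ0.le
  have hAℓ : A * 420 ≤ A * ℓ := mul_le_mul_of_nonneg_left (by linarith) hA
  have hΛL' : Λ ≤ L := by linarith
  have hΛ0 : 0 < Λ := by linarith
  have hpΛ : 100 * p ≤ Λ := by
    have h1 : (p : ℝ) * 400 ≤ p * ℓ ^ 2 := mul_le_mul_of_nonneg_left (by linarith) hp0.le
    linarith
  obtain ⟨k, j₀, n₀, w, hn₀, hnj, hN, ha, hw, hwn⟩ := exists_chain_parameters hp.two_le hpΛ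
  rw [hcΛ] at ha hw
  have hN' : (j₀ + n₀) * p ^ (k + 1) ≤ N := by
    have h1 : (2 : ℝ) * Λ * Real.exp Λ ≤ N := by
      have h2 := Real.quadratic_le_exp_of_nonneg (show 0 ≤ L / 2 by linarith)
      calc 2 * Λ * Real.exp Λ ≤ Real.exp (L / 2) * Real.exp (L / 2) := by
            gcongr
            nlinarith
        _ = N := by rw [← Real.exp_add, add_halves, hLN]
    exact_mod_cast hN.trans h1
  have ha' : 4 * Λ * Real.exp (-(Λ / p / 100)) ≤ Real.exp (-(A + 4)) := by
    have h4 : (4 : ℝ) ≤ Real.exp 3 := by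
      have := Real.add_one_le_exp 3
      linarith
    calc 4 * Λ * Real.exp (-(Λ / p / 100)) ≤ Real.exp 3 * Real.exp ℓ *
          Real.exp (-(ℓ ^ 2 / 4 / 100)) := by
          rw [hℓL]
          gcongr
      _ = Real.exp (3 + ℓ - ℓ ^ 2 / 400) := by
          rw [← Real.exp_add, ← Real.exp_add]; congr 1; ring
      _ ≤ _ := by
          rw [Real.exp_le_exp]
          linarith
  have hwn' : L ^ 2 ≤ w * n₀ := by
    refine le_trans ?_ hwn
    have h64 : (64 : ℝ) ≤ Real.exp 6 := by
      have h2 : (2 : ℝ) ≤ Real.exp 1 := by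
        have := Real.add_one_le_exp 1
        linarith
      calc (64 : ℝ) = 2 ^ 6 := by norm_num
        _ ≤ Real.exp 1 ^ 6 := by gcongr
        _ = Real.exp 6 := by rw [← Real.exp_nat_mul]; norm_num
    rw [le_div_iff₀ (by positivity)]
    calc L ^ 2 * (64 * p * Λ ^ 4) ≤ L ^ 2 * (Real.exp 6 * L * L ^ 4) := by
          gcongr
      _ = Real.exp ℓ ^ 7 * Real.exp 6 := by rw [hℓL]; ring
      _ = Real.exp (7 * ℓ + 6) := by rw [← Real.exp_nat_mul, ← Real.exp_add]; norm_num
      _ ≤ _ := by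
          rw [Real.exp_le_exp]
          linarith
  obtain ⟨B, hB1, hB2⟩ := exists_finset_forall_card_filter_not_dvd_le hc hR hp hn₀ hnj hN'
    (a := A + 4) (w := w) (fun j hj => (ha j hj).trans ha') hw ⌈L⌉₊
  have hJ1 : L ≤ ⌈L⌉₊ := Nat.le_ceil _
  have hJ2 : (⌈L⌉₊ : ℝ) < L + 1 := Nat.ceil_lt_add_one hL0.le
  have key : ∀ t : ℝ, t ≤ -((A + 4) * L) →
      Fintype.card N.Partition * Real.exp (A * L + M) * Real.exp t ≤
        Fintype.card N.Partition * Real.exp (M - 4 * L) := by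
    intro t ht
    rw [mul_assoc, ← Real.exp_add]
    gcongr
    linarith
  refine ⟨B, hB1.trans (key _ ?_), fun F hF g π hg hπ => (hB2 F hF g π hg hπ).trans (key _ ?_)⟩
  · have h1 : (2 * A + 12) * L ≤ L ^ 2 := by
      rw [sq]; exact mul_le_mul_of_nonneg_right hL hL0.le
    linarith
  · have h1 : (A + 4) * L ≤ (A + 4) * ⌈L⌉₊ := mul_le_mul_of_nonneg_left hJ1 (by linarith)
    linarith

/-- For every `ε > 0` there exists `N₀` such that for all `N ≥ N₀`, the
number of pairs `(χ, c)`, with `χ` an irreducible complex character of `S_N` and `c` a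
conjugacy class of `S_N`, such that the value of `χ` on `c` is not a multiple of
`∏_{p prime, p ≤ (log N)/(log log N)²} p`, is at most `ε · p(N)²`. -/
theorem almost_all_character_entries_divisible :
    ∀ ε : ℝ, 0 < ε → ∃ N₀ : ℕ, ∀ N : ℕ, N₀ ≤ N →
      (Set.ncard {χc : (Equiv.Perm (Fin N) → ℂ) × ConjClasses (Equiv.Perm (Fin N)) |
          (∃ V : FDRep ℂ (Equiv.Perm (Fin N)), Simple V ∧ χc.1 = V.character) ∧
          ∀ g : Equiv.Perm (Fin N), ConjClasses.mk g = χc.2 →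
            ¬ ∃ m : ℤ,
              χc.1 g =
                ((∏ q ∈ Nat.primesBelow
                    (⌊Real.log N / (Real.log (Real.log N)) ^ 2⌋₊ + 1), q : ℕ) : ℂ) *
                  (m : ℂ)} : ℝ) ≤
        ε * (Fintype.card (Nat.Partition N) : ℝ) ^ 2 := by
  intro ε hε
  obtain ⟨A, M, hA, hAM⟩ := Nat.Partition.exists_exp_pi_sq_div_le
  have hlog : Filter.Tendsto (fun N : ℕ => Real.log N) Filter.atTop Filter.atTop :=
    Real.tendsto_log_atTop.comp tendsto_natCast_atTop_atTop
  have hev := ((hlog.eventually_ge_atTop (max (2 * A + 12) (M + 1 - Real.log ε))).and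
    ((Real.tendsto_log_atTop.comp hlog).eventually_ge_atTop (A + 420))).and
    (Filter.eventually_gt_atTop 0)
  obtain ⟨N₀, hN₀⟩ := Filter.eventually_atTop.1 hev
  refine ⟨N₀, fun N hN => ?_⟩
  obtain ⟨⟨hL, hℓ⟩, hN0⟩ := hN₀ N hN
  obtain ⟨hL1, hL2⟩ := max_le_iff.1 hL
  rw [Function.comp_apply] at hℓ
  have hN0r : (0 : ℝ) < N := by exact_mod_cast hN0
  set L := Real.log N with hLdef
  set K := ⌊L / Real.log L ^ 2⌋₊ with hK
  have hL0 : 0 < L := by linarith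
  have hKle : (K : ℝ) ≤ L / Real.log L ^ 2 := Nat.floor_le (by positivity)
  have hKL : (K : ℝ) ≤ L := hKle.trans (div_le_self hL0.le (by nlinarith))
  have hc : 0 < √(Real.pi ^ 2 / 6 / N) := Real.sqrt_pos.2 (by positivity)
  have hcN : √(Real.pi ^ 2 / 6 / N) ^ 2 * N = Real.pi ^ 2 / 6 := by
    rw [Real.sq_sqrt (by positivity), div_mul_cancel₀ _ hN0r.ne']
  have hR := hAM N hN0 _ hc hcN
  have hB : ∀ p ∈ Nat.primesBelow (K + 1), _ := fun p hp =>
    exists_finset_card_le_of_prime_le hA (Nat.prime_of_mem_primesBelow hp) hc hcN hR hL1 hℓ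
      (le_trans (Nat.cast_le.2 (Nat.lt_succ_iff.1 (Nat.lt_of_mem_primesBelow hp))) hKle)
  choose! B hB1 hB2 using hB
  have hcard : ((Nat.primesBelow (K + 1)).card : ℝ) ≤ Real.exp L := by
    have h1 : (Nat.primesBelow (K + 1)).card ≤ K + 1 :=
      (Finset.card_filter_le _ _).trans (Finset.card_range _).le
    have h2 : ((Nat.primesBelow (K + 1)).card : ℝ) ≤ K + 1 := by exact_mod_cast h1
    linarith [Real.add_one_le_exp L]
  have h2e : (2 : ℝ) ≤ Real.exp 1 := by linarith [Real.add_one_le_exp 1]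
  set Q := (Fintype.card N.Partition : ℝ)
  have hQ : 0 ≤ Q := Nat.cast_nonneg _
  refine (ncard_not_dvd_le (Nat.primesBelow (K + 1)) (fun p hp => Nat.prime_of_mem_primesBelow hp)
    B (fun _ => Q * Real.exp (M - 4 * L)) (fun _ _ => by positivity) hB2).trans ?_
  calc ∑ p ∈ Nat.primesBelow (K + 1), ((B p).card * Q + Q * (Q * Real.exp (M - 4 * L)))
      ≤ ∑ p ∈ Nat.primesBelow (K + 1),
          (Q * Real.exp (M - 4 * L) * Q + Q * (Q * Real.exp (M - 4 * L))) := by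
        gcongr with p hp
        exact hB1 p hp
    _ = (Nat.primesBelow (K + 1)).card * (2 * Real.exp (M - 4 * L)) * Q ^ 2 := by
        rw [Finset.sum_const, nsmul_eq_mul]; ring
    _ ≤ Real.exp L * (Real.exp 1 * Real.exp (M - 4 * L)) * Q ^ 2 := by gcongr
    _ = Real.exp (M + 1 - 3 * L) * Q ^ 2 := by
        rw [← Real.exp_add, ← Real.exp_add]; ring_nf
    _ ≤ Real.exp (Real.log ε) * Q ^ 2 := by gcongr; linarith
    _ = ε * Q ^ 2 := by rw [Real.exp_log hε]
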